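/- arXiv:1002.4466 — 8 statements merged into one kernel-verified Lean document; each statement's English description precedes it below -/
import Mathlib

section
/- Let (R, 𝔪) be a two-dimensional regular local ring with infinite residue field and let I be an 𝔪-primary ideal. Then I is contracted if and only if I has minimal mixed multiplicity, i.e., if and only if there exist x ∈ 𝔪 and a ∈ I forming a joint reduction of (𝔪, I) such that 𝔪I = xI + a𝔪. -/
open IsLocalRing

/-- A Noetherian local ring is regular if its maximal ideal can be generated by
`dim R` many elements. -/
def IsRegularLocal (R : Type*) [CommRing R] [IsLocalRing R] : Prop :=
  IsNoetherianRing R ∧ ∃ s : Finset R, Ideal.span (s : Set R) = maximalIdeal R ∧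
    (s.card : WithBot ℕ∞) = ringKrullDim R

/-- An ideal is `𝔪`-primary. -/
def IsMPrimary (R : Type*) [CommRing R] [IsLocalRing R] (I : Ideal R) : Prop :=
  I.IsPrimary ∧ I.radical = maximalIdeal R

/-- The subring `S = R[𝔪/x]` of the fraction field of `R`. -/
noncomputable def adjoinMDivX (R : Type*) [CommRing R] [IsLocalRing R] (x : R) :
    Subalgebra R (FractionRing R) :=
  Algebra.adjoin R {y : FractionRing R | ∃ m ∈ maximalIdeal R,
    y * algebraMap R (FractionRing R) x = algebraMap R (FractionRing R) m}

/-- An ideal `I` of a local ring `(R, 𝔪)` is contracted if `I = IS ∩ R` for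
some `S = R[𝔪/x]` with `x ∈ 𝔪 \ 𝔪²`. -/
def IsContracted (R : Type*) [CommRing R] [IsLocalRing R] (I : Ideal R) : Prop :=
  ∃ x ∈ maximalIdeal R, x ∉ (maximalIdeal R) ^ 2 ∧
    Ideal.comap (algebraMap R (adjoinMDivX R x))
      (Ideal.map (algebraMap R (adjoinMDivX R x)) I) = I

/-- `(x, a)` is a joint reduction of the pair of ideals `(J, K)`:
`x ∈ J`, `a ∈ K` and `(xK + aJ)(JK)^{n-1} = (JK)^n` for some `n ≥ 1`. -/
def IsJointReduction {R : Type*} [CommRing R] (J K : Ideal R) (x a : R) : Prop :=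
  x ∈ J ∧ a ∈ K ∧ ∃ n : ℕ, 0 < n ∧
    (Ideal.span {x} * K + Ideal.span {a} * J) * (J * K) ^ (n - 1) = (J * K) ^ n

/-- An `𝔪`-primary ideal `I` in a two-dimensional local ring has minimal mixed
multiplicity: there is a joint reduction `(x, a)` of `(𝔪, I)` with `𝔪I = xI + a𝔪`. -/
def HasMinimalMixedMultiplicity₂ (R : Type*) [CommRing R] [IsLocalRing R]
    (I : Ideal R) : Prop :=
  ∃ x a : R, IsJointReduction (maximalIdeal R) I x a ∧
    maximalIdeal R * I = Ideal.span {x} * I + Ideal.span {a} * maximalIdeal R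

/-- By Krull's principal ideal theorem, the maximal ideal of a two-dimensional Noetherian local
ring is not minimal over a principal ideal. -/
lemma maximalIdeal_notMem_minimalPrimes_span_singleton {R : Type*} [CommRing R] [IsLocalRing R]
    [IsNoetherianRing R] (hdim : ringKrullDim R = 2) (x : R) :
    maximalIdeal R ∉ (Ideal.span {x}).minimalPrimes := by
  intro hmin
  have h1 := Ideal.height_le_one_of_isPrincipal_of_mem_minimalPrimes (Ideal.span {x})
    (maximalIdeal R) hmin
  have h2 := maximalIdeal_height_eq_ringKrullDim (R := R)
  rw [hdim] at h2
  have h3 : (maximalIdeal R).height = 2 :=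
    WithBot.coe_injective (h2.trans (by norm_num))
  rw [h3] at h1
  exact absurd h1 (by decide)

/-- In a two-dimensional Noetherian local ring, a proper principal ideal contains no power of the
maximal ideal. -/
lemma not_maximalIdeal_pow_le_span_singleton {R : Type*} [CommRing R] [IsLocalRing R]
    [IsNoetherianRing R] (hdim : ringKrullDim R = 2) {x : R} (hx : x ∈ maximalIdeal R) (n : ℕ) :
    ¬ maximalIdeal R ^ n ≤ Ideal.span {x} := by
  intro h
  refine maximalIdeal_notMem_minimalPrimes_span_singleton hdim x
    ⟨⟨inferInstance, (Ideal.span_singleton_le_iff_mem _).2 hx⟩, ?_⟩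
  rintro P ⟨hP, hxP⟩ -
  exact hP.le_of_pow_le (h.trans hxP)

/-- A Noetherian local ring whose maximal ideal is generated by a non-nilpotent element is a
domain. -/
lemma isDomain_of_maximalIdeal_eq_span_singleton {A : Type*} [CommRing A] [IsLocalRing A]
    [IsNoetherianRing A] {t : A} (ht : maximalIdeal A = Ideal.span {t})
    (hnil : ¬ IsNilpotent t) : IsDomain A := by
  have key : ∀ a : A, a ≠ 0 → ∃ (n : ℕ) (u : A), IsUnit u ∧ a = t ^ n * u := by
    intro a ha
    have hex : ∃ n : ℕ, ¬ t ^ n ∣ a := by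
      by_contra! hall
      apply ha
      have hmem : a ∈ ⨅ n : ℕ, maximalIdeal A ^ n := by
        rw [Ideal.mem_iInf]
        intro n
        rw [ht, Ideal.span_singleton_pow, Ideal.mem_span_singleton]
        exact hall n
      rwa [Ideal.iInf_pow_eq_bot_of_isLocalRing _ (maximalIdeal.isMaximal A).ne_top,
        Ideal.mem_bot] at hmem
    classical
    obtain ⟨n, hn⟩ : ∃ n, Nat.find hex = n + 1 := by
      refine Nat.exists_eq_succ_of_ne_zero fun h0 ↦ ?_
      have := Nat.find_spec hex
      rw [h0] at this
      simp at this
    have hdvd : t ^ n ∣ a := not_not.1 (Nat.find_min hex (by omega))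
    obtain ⟨u, rfl⟩ := hdvd
    refine ⟨n, u, ?_, rfl⟩
    by_contra hu
    have hu' : u ∈ maximalIdeal A := hu
    rw [ht, Ideal.mem_span_singleton] at hu'
    have := Nat.find_spec hex
    rw [hn, pow_succ] at this
    exact this (mul_dvd_mul_left _ hu')
  have : NoZeroDivisors A := by
    refine ⟨fun {a b} hab ↦ ?_⟩
    by_contra! h
    obtain ⟨n, u, hu, rfl⟩ := key a h.1
    obtain ⟨k, v, hv, rfl⟩ := key b h.2
    refine hnil ⟨n + k, ?_⟩
    rw [← (hu.mul hv).mul_left_eq_zero, ← hab]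
    ring
  exact NoZeroDivisors.to_isDomain A

lemma exists_maximalIdeal_eq_span_pair {R : Type*} [CommRing R] [IsLocalRing R]
    (hreg : IsRegularLocal R) (hdim : ringKrullDim R = 2) {x : R} (hx : x ∈ maximalIdeal R)
    (hx2 : x ∉ maximalIdeal R ^ 2) : ∃ y, maximalIdeal R = Ideal.span {x, y} := by
  obtain ⟨-, s, hs, hcard⟩ := hreg
  rw [hdim] at hcard
  have hcard' : s.card = 2 := by exact_mod_cast hcard
  classical
  obtain ⟨p, q, -, rfl⟩ := Finset.card_eq_two.1 hcard'
  have hpq : Ideal.span {p, q} = maximalIdeal R := by simpa using hs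
  have hp : p ∈ maximalIdeal R := hpq ▸ Ideal.subset_span (by simp)
  have hq : q ∈ maximalIdeal R := hpq ▸ Ideal.subset_span (by simp)
  have main : ∀ (p q α β : R), Ideal.span {p, q} = maximalIdeal R → x = α * p + β * q →
      IsUnit α → maximalIdeal R = Ideal.span {x, q} := by
    intro p q α β hpq hxe hα
    apply le_antisymm
    · rw [← hpq, Ideal.span_le, Set.pair_subset_iff]
      obtain ⟨γ, hγ⟩ := hα.exists_left_inv
      refine ⟨Ideal.mem_span_pair.2 ⟨γ, -(γ * β), ?_⟩, Ideal.subset_span (by simp)⟩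
      rw [hxe]
      linear_combination p * hγ
    · rw [Ideal.span_le, Set.pair_subset_iff]
      exact ⟨hx, hpq ▸ Ideal.subset_span (by simp)⟩
  obtain ⟨α, β, hαβ⟩ := Ideal.mem_span_pair.1 (hpq ▸ hx)
  by_cases hα : IsUnit α
  · exact ⟨q, main p q α β hpq hαβ.symm hα⟩
  by_cases hβ : IsUnit β
  · exact ⟨p, main q p β α (by rwa [Set.pair_comm]) (by rw [← hαβ, add_comm]) hβ⟩
  · refine absurd ?_ hx2
    rw [← hαβ, pow_two]
    exact add_mem (Ideal.mul_mem_mul hα hp) (Ideal.mul_mem_mul hβ hq)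

/-- If `𝔪 = (x, y)` in a two-dimensional Noetherian local ring, then `R / (x)` is a domain whose
ideals are all principal. -/
lemma isDomain_and_isPrincipalIdealRing_quotient {R : Type*} [CommRing R] [IsLocalRing R]
    [IsNoetherianRing R] (hdim : ringKrullDim R = 2) {x y : R}
    (hxy : maximalIdeal R = Ideal.span {x, y}) :
    IsDomain (R ⧸ Ideal.span {x}) ∧ IsPrincipalIdealRing (R ⧸ Ideal.span {x}) := by
  have hx : x ∈ maximalIdeal R := hxy ▸ Ideal.subset_span (by simp)
  have hle : Ideal.span {x} ≤ maximalIdeal R := (Ideal.span_singleton_le_iff_mem _).2 hx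
  have : Nontrivial (R ⧸ Ideal.span {x}) :=
    Ideal.Quotient.nontrivial_iff.2 fun h ↦ (maximalIdeal.isMaximal R).ne_top (top_le_iff.1 (h ▸ hle))
  have hsurj := Ideal.Quotient.mk_surjective (I := Ideal.span {x})
  have : IsLocalRing (R ⧸ Ideal.span {x}) := .of_surjective' _ hsurj
  have : IsLocalHom (Ideal.Quotient.mk (Ideal.span {x})) := .of_surjective _ hsurj
  have ht : maximalIdeal (R ⧸ Ideal.span {x}) =
      Ideal.span {Ideal.Quotient.mk (Ideal.span {x}) y} := by
    have hmap : (maximalIdeal R).map (Ideal.Quotient.mk (Ideal.span {x})) =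
        maximalIdeal (R ⧸ Ideal.span {x}) := by
      have hcomap : (maximalIdeal (R ⧸ Ideal.span {x})).comap (Ideal.Quotient.mk (Ideal.span {x})) =
          maximalIdeal R := ((local_hom_TFAE _).out 0 4).1 ‹_›
      rw [← hcomap, Ideal.map_comap_of_surjective _ hsurj]
    rw [← hmap, hxy, Ideal.map_span, Set.image_pair,
      Ideal.Quotient.eq_zero_iff_mem.2 (Ideal.mem_span_singleton_self x), Ideal.span_insert_zero]
  have hdom : IsDomain (R ⧸ Ideal.span {x}) := by
    refine isDomain_of_maximalIdeal_eq_span_singleton ht ?_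
    rintro ⟨n, hn⟩
    rw [← map_pow, Ideal.Quotient.eq_zero_iff_mem] at hn
    refine not_maximalIdeal_pow_le_span_singleton hdim hx (1 + n) ?_
    rw [hxy, Ideal.span_insert]
    refine Ideal.sup_pow_add_le_pow_sup_pow.trans ?_
    rw [pow_one, Ideal.span_singleton_pow]
    exact sup_le le_rfl ((Ideal.span_singleton_le_iff_mem _).2 hn)
  refine ⟨hdom, ?_⟩
  have hprin : (maximalIdeal (R ⧸ Ideal.span {x})).IsPrincipal := ⟨⟨_, ht⟩⟩
  exact ((tfae_of_isNoetherianRing_of_isLocalRing_of_isDomain _).out 0 4).2 hprin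

lemma isPrime_span_singleton {R : Type*} [CommRing R] [IsLocalRing R]
    (hreg : IsRegularLocal R) (hdim : ringKrullDim R = 2) {x : R} (hx : x ∈ maximalIdeal R)
    (hx2 : x ∉ maximalIdeal R ^ 2) : (Ideal.span {x}).IsPrime := by
  have := hreg.1
  obtain ⟨y, hxy⟩ := exists_maximalIdeal_eq_span_pair hreg hdim hx hx2
  have := (isDomain_and_isPrincipalIdealRing_quotient hdim hxy).1
  exact (Ideal.Quotient.isDomain_iff_prime _).1 this

lemma isDomain_of_isRegularLocal {R : Type*} [CommRing R] [IsLocalRing R]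
    (hreg : IsRegularLocal R) (hdim : ringKrullDim R = 2) : IsDomain R := by
  have := hreg.1
  have hfin := minimalPrimes.finite_of_isNoetherianRing R
  have hjac : maximalIdeal R ≤ Ideal.jacobson ⊥ := (jacobson_eq_maximalIdeal ⊥ bot_ne_top).ge
  obtain ⟨x, hx, hxn⟩ : ∃ x ∈ maximalIdeal R, x ∉ ⋃ P ∈
      ((insert (maximalIdeal R ^ 2) hfin.toFinset : Finset (Ideal R)) : Set (Ideal R)),
      (P : Set R) := by
    refine Set.not_subset.1 fun hsub ↦ ?_
    rw [Ideal.subset_union_prime (f := fun P : Ideal R ↦ P) (maximalIdeal R ^ 2)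
      (maximalIdeal R ^ 2)] at hsub
    · obtain ⟨P, hP, hle⟩ := hsub
      rw [Finset.mem_insert, Set.Finite.mem_toFinset] at hP
      rcases hP with rfl | hP
      · refine not_maximalIdeal_pow_le_span_singleton hdim (zero_mem (maximalIdeal R)) 1 ?_
        rw [pow_one, Ideal.span_singleton_zero]
        refine Submodule.le_of_le_smul_of_le_jacobson_bot (IsNoetherian.noetherian _) hjac ?_
        rwa [bot_sup_eq, smul_eq_mul, ← pow_two]
      · have := hP.1.1
        have hPm : P = maximalIdeal R := le_antisymm (le_maximalIdeal this.ne_top) hle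
        apply maximalIdeal_notMem_minimalPrimes_span_singleton hdim 0
        rwa [Ideal.span_singleton_zero, ← hPm]
    · intro P hP hP2 _
      rw [Finset.mem_insert, Set.Finite.mem_toFinset] at hP
      exact (hP.resolve_left hP2).1.1
  simp only [Set.mem_iUnion, not_exists] at hxn
  have hx2 : x ∉ maximalIdeal R ^ 2 := hxn _ (by simp)
  have := isPrime_span_singleton hreg hdim hx hx2
  obtain ⟨Q, hQ, hQx⟩ := Ideal.exists_minimalPrimes_le (bot_le (a := Ideal.span {x}))
  have hxQ : x ∉ Q := hxn Q (by simpa using Or.inr hQ)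
  have hQp : Q.IsPrime := hQ.1.1
  have hQ0 : Q ≤ ⊥ := by
    refine Submodule.le_of_le_smul_of_le_jacobson_bot (IsNoetherian.noetherian _) hjac ?_
    rw [bot_sup_eq, smul_eq_mul]
    intro q hq
    obtain ⟨r, rfl⟩ := Ideal.mem_span_singleton.1 (hQx hq)
    exact Ideal.mul_mem_mul hx ((hQp.mem_or_mem hq).resolve_left hxQ)
  rw [le_bot_iff] at hQ0
  exact IsDomain.of_bot_isPrime R (hbp := hQ0 ▸ hQp)

/-- If `M = (x, y)` then `Mⁿ⁺¹ ⊆ xMⁿ + (yⁿ⁺¹)`. -/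
lemma pow_succ_le_span_mul_pow_sup {R : Type*} [CommRing R] {M : Ideal R} {x y : R}
    (hxy : M = Ideal.span {x, y}) (n : ℕ) :
    M ^ (n + 1) ≤ Ideal.span {x} * M ^ n ⊔ Ideal.span {y ^ (n + 1)} := by
  have hy : y ∈ M := hxy ▸ Ideal.subset_span (by simp)
  induction n with
  | zero => simp [hxy, Ideal.span_insert]
  | succ n ih =>
    calc M ^ (n + 1 + 1) = M * M ^ (n + 1) := pow_succ' _ _
      _ ≤ M * (Ideal.span {x} * M ^ n ⊔ Ideal.span {y ^ (n + 1)}) := Ideal.mul_mono_right ih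
      _ = Ideal.span {x} * M ^ (n + 1) ⊔ M * Ideal.span {y ^ (n + 1)} := by
        rw [Ideal.mul_sup, mul_left_comm, ← pow_succ']
      _ ≤ _ := by
        refine sup_le le_sup_left ?_
        nth_rw 1 [hxy]
        rw [Ideal.span_insert, Ideal.sup_mul, Ideal.span_singleton_mul_span_singleton y,
          ← pow_succ']
        refine sup_le_sup_right (Ideal.mul_mono_right ?_) _
        exact (Ideal.span_singleton_le_iff_mem _).2 (Ideal.pow_mem_pow hy _)

/-- The colon ideal of `𝔪ⁿ⁺¹` by `x ∈ 𝔪 \ 𝔪²` is `𝔪ⁿ`. -/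
lemma mem_maximalIdeal_pow_of_mul_mem {R : Type*} [CommRing R] [IsLocalRing R]
    (hreg : IsRegularLocal R) (hdim : ringKrullDim R = 2) {x : R} (hx : x ∈ maximalIdeal R)
    (hx2 : x ∉ maximalIdeal R ^ 2) {n : ℕ} {c : R} (hc : x * c ∈ maximalIdeal R ^ (n + 1)) :
    c ∈ maximalIdeal R ^ n := by
  have := hreg.1
  have := isDomain_of_isRegularLocal hreg hdim
  have hp := isPrime_span_singleton hreg hdim hx hx2
  obtain ⟨y, hxy⟩ := exists_maximalIdeal_eq_span_pair hreg hdim hx hx2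
  have hy : y ∈ maximalIdeal R := hxy ▸ Ideal.subset_span (by simp)
  have hyx : y ∉ Ideal.span {x} := by
    intro hyx
    refine not_maximalIdeal_pow_le_span_singleton hdim hx 1 ?_
    rw [pow_one, hxy, Ideal.span_le, Set.pair_subset_iff]
    exact ⟨Ideal.mem_span_singleton_self x, hyx⟩
  have hx0 : x ≠ 0 := by
    rintro rfl
    exact hx2 (zero_mem _)
  obtain ⟨u, hu, v, hv, huv⟩ := Submodule.mem_sup.1 (pow_succ_le_span_mul_pow_sup hxy n hc)
  obtain ⟨d, hd, rfl⟩ := Ideal.mem_span_singleton_mul.1 hu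
  obtain ⟨e, rfl⟩ := Ideal.mem_span_singleton.1 hv
  have he : y ^ (n + 1) * e ∈ Ideal.span {x} :=
    Ideal.mem_span_singleton.2 ⟨c - d, by linear_combination huv⟩
  obtain ⟨f, rfl⟩ := Ideal.mem_span_singleton.1
    ((hp.mem_or_mem he).resolve_left fun h ↦ hyx (hp.mem_of_pow_mem _ h))
  have hcd : c = d + y ^ n * (y * f) :=
    mul_left_cancel₀ hx0 (by linear_combination -huv)
  rw [hcd]
  exact add_mem hd (Ideal.mul_mem_right _ _ (Ideal.pow_mem_pow hy n))

lemma hasMinimalMixedMultiplicity_of_comap_map_eq {R : Type*} [CommRing R] [IsLocalRing R]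
    (hreg : IsRegularLocal R) (hdim : ringKrullDim R = 2) {x : R} (hx : x ∈ maximalIdeal R)
    (hx2 : x ∉ maximalIdeal R ^ 2) {I : Ideal R}
    (hc : Ideal.comap (algebraMap R (adjoinMDivX R x))
      (Ideal.map (algebraMap R (adjoinMDivX R x)) I) = I) :
    HasMinimalMixedMultiplicity₂ R I := by
  have := hreg.1
  have := isDomain_of_isRegularLocal hreg hdim
  obtain ⟨y, hxy⟩ := exists_maximalIdeal_eq_span_pair hreg hdim hx hx2
  have := (isDomain_and_isPrincipalIdealRing_quotient hdim hxy).2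
  have hx0 : x ≠ 0 := by
    rintro rfl
    exact hx2 (zero_mem _)
  have hx0' : algebraMap R (FractionRing R) x ≠ 0 := by simpa using hx0
  have hcolon : ∀ b, x * b ∈ I → ∀ m ∈ maximalIdeal R, m * b ∈ I := by
    intro b hb m hm
    rw [← hc, Ideal.mem_comap]
    let s : adjoinMDivX R x := ⟨algebraMap R (FractionRing R) m / algebraMap R (FractionRing R) x,
      Algebra.subset_adjoin ⟨m, hm, div_mul_cancel₀ _ hx0'⟩⟩
    have hs : algebraMap R (adjoinMDivX R x) (m * b) =
        s * algebraMap R (adjoinMDivX R x) (x * b) := by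
      apply Subtype.ext
      change algebraMap R (FractionRing R) (m * b) =
        algebraMap R (FractionRing R) m / algebraMap R (FractionRing R) x *
          algebraMap R (FractionRing R) (x * b)
      rw [map_mul, map_mul]
      field_simp
    rw [hs]
    exact Ideal.mul_mem_left _ _ (Ideal.mem_map_of_mem _ hb)
  obtain ⟨g, hg⟩ := (IsPrincipalIdealRing.principal
    (I.map (Ideal.Quotient.mk (Ideal.span {x})))).principal
  rw [← Ideal.span] at hg
  have hgI : g ∈ I.map (Ideal.Quotient.mk (Ideal.span {x})) :=
    hg ▸ Ideal.mem_span_singleton_self g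
  obtain ⟨a, ha, rfl⟩ := (Ideal.mem_map_iff_of_surjective _ Ideal.Quotient.mk_surjective).1 hgI
  have heq : maximalIdeal R * I = Ideal.span {x} * I + Ideal.span {a} * maximalIdeal R := by
    apply le_antisymm
    · rw [Ideal.mul_le]
      intro m hm i hi
      have hi' := Ideal.mem_map_of_mem (Ideal.Quotient.mk (Ideal.span {x})) hi
      rw [hg, Ideal.mem_span_singleton] at hi'
      obtain ⟨r, hr⟩ := hi'
      obtain ⟨r, rfl⟩ := Ideal.Quotient.mk_surjective r
      rw [← map_mul, Ideal.Quotient.eq, Ideal.mem_span_singleton] at hr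
      obtain ⟨b, hb⟩ := hr
      have hxb : x * b ∈ I := hb ▸ sub_mem hi (Ideal.mul_mem_right _ _ ha)
      have hmi : m * i = x * (m * b) + a * (m * r) := by linear_combination m * hb
      rw [hmi]
      exact Submodule.add_mem_sup
        (Ideal.mul_mem_mul (Ideal.mem_span_singleton_self x) (hcolon b hxb m hm))
        (Ideal.mul_mem_mul (Ideal.mem_span_singleton_self a) (Ideal.mul_mem_right _ _ hm))
    · refine sup_le (Ideal.mul_mono_left ((Ideal.span_singleton_le_iff_mem _).2 hx)) ?_
      rw [mul_comm]
      exact Ideal.mul_mono_right ((Ideal.span_singleton_le_iff_mem _).2 ha)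
  refine ⟨x, a, ⟨hx, ha, 1, one_pos, ?_⟩, heq⟩
  rw [Nat.sub_self, pow_zero, mul_one, pow_one, heq]

lemma notMem_sq_of_maximalIdeal_mul_eq {R : Type*} [CommRing R] [IsLocalRing R]
    [IsNoetherianRing R] (hdim : ringKrullDim R = 2) {I : Ideal R} {x a : R}
    (ha : a ∈ maximalIdeal R) {n : ℕ} (hn : maximalIdeal R ^ n ≤ I)
    (h : maximalIdeal R * I = Ideal.span {x} * I + Ideal.span {a} * maximalIdeal R) :
    x ∉ maximalIdeal R ^ 2 := by
  intro hx2
  refine not_maximalIdeal_pow_le_span_singleton hdim ha (n + 1) ?_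
  rw [pow_succ']
  refine (Ideal.mul_mono_right hn).trans ?_
  refine Submodule.le_of_le_smul_of_le_jacobson_bot (IsNoetherian.noetherian _)
    (jacobson_eq_maximalIdeal ⊥ bot_ne_top).ge ?_
  rw [smul_eq_mul, ← mul_assoc, ← pow_two]
  conv_lhs => rw [h]
  rw [Submodule.add_eq_sup, sup_comm]
  exact sup_le_sup Ideal.mul_le_left
    (Ideal.mul_mono_left ((Ideal.span_singleton_le_iff_mem _).2 hx2))

/-- If `𝔪I = xI + a𝔪`, then `I𝔪ⁿ⁺¹ : x = I𝔪ⁿ`. -/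
lemma mem_mul_maximalIdeal_pow_of_mul_mem {R : Type*} [CommRing R] [IsLocalRing R]
    (hreg : IsRegularLocal R) (hdim : ringKrullDim R = 2) {I : Ideal R} {x a : R}
    (hx : x ∈ maximalIdeal R) (hx2 : x ∉ maximalIdeal R ^ 2) (ha : a ∈ I) {n : ℕ}
    (hn : maximalIdeal R ^ n ≤ I)
    (h : maximalIdeal R * I = Ideal.span {x} * I + Ideal.span {a} * maximalIdeal R)
    {k : ℕ} {z : R} (hz : x * z ∈ I * maximalIdeal R ^ (k + 1)) :
    z ∈ I * maximalIdeal R ^ k := by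
  have := hreg.1
  have := isDomain_of_isRegularLocal hreg hdim
  have hp := isPrime_span_singleton hreg hdim hx hx2
  have hax : a ∉ Ideal.span {x} := by
    intro hax
    refine not_maximalIdeal_pow_le_span_singleton hdim hx (n + 1) ?_
    rw [pow_succ']
    refine (Ideal.mul_mono_right hn).trans ?_
    rw [h]
    exact sup_le Ideal.mul_le_left
      (Ideal.mul_le_left.trans ((Ideal.span_singleton_le_iff_mem _).2 hax))
  have hx0 : x ≠ 0 := by
    rintro rfl
    exact hx2 (zero_mem _)
  have hpow : I * maximalIdeal R ^ (k + 1) =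
      Ideal.span {x} * (I * maximalIdeal R ^ k) ⊔ Ideal.span {a} * maximalIdeal R ^ (k + 1) := by
    rw [pow_succ', ← mul_assoc, mul_comm I, h, add_mul, mul_assoc, mul_assoc,
      Submodule.add_eq_sup]
  rw [hpow] at hz
  obtain ⟨u, hu, v, hv, huv⟩ := Submodule.mem_sup.1 hz
  obtain ⟨j, hj, rfl⟩ := Ideal.mem_span_singleton_mul.1 hu
  obtain ⟨m, hm, rfl⟩ := Ideal.mem_span_singleton_mul.1 hv
  have ham : a * m ∈ Ideal.span {x} :=
    Ideal.mem_span_singleton.2 ⟨z - j, by linear_combination huv⟩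
  obtain ⟨c, rfl⟩ := Ideal.mem_span_singleton.1 ((hp.mem_or_mem ham).resolve_left hax)
  have hzj : z = j + a * c := mul_left_cancel₀ hx0 (by linear_combination -huv)
  rw [hzj]
  exact add_mem hj (Ideal.mul_mem_mul ha (mem_maximalIdeal_pow_of_mul_mem hreg hdim hx hx2 hm))

/-- Every element of `R[𝔪/x]` has the form `m / xᵏ` with `m ∈ 𝔪ᵏ`. -/
lemma exists_pow_mul_eq_of_mem_adjoinMDivX {R : Type*} [CommRing R] [IsLocalRing R] {x : R}
    (hx : x ∈ maximalIdeal R) {s : FractionRing R} (hs : s ∈ adjoinMDivX R x) :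
    ∃ k : ℕ, ∃ m ∈ maximalIdeal R ^ k,
      algebraMap R (FractionRing R) x ^ k * s = algebraMap R (FractionRing R) m := by
  induction hs using Algebra.adjoin_induction with
  | mem s hs =>
    obtain ⟨m, hm, hsm⟩ := hs
    exact ⟨1, m, by simpa using hm, by rw [← hsm, pow_one, mul_comm]⟩
  | algebraMap r => exact ⟨0, r, by simp, by simp⟩
  | add s t _ _ hs ht =>
    obtain ⟨k, m, hm, hsm⟩ := hs
    obtain ⟨l, m', hm', htm⟩ := ht
    refine ⟨k + l, x ^ l * m + x ^ k * m', add_mem ?_ ?_, ?_⟩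
    · rw [add_comm, pow_add]
      exact Ideal.mul_mem_mul (Ideal.pow_mem_pow hx l) hm
    · rw [pow_add]
      exact Ideal.mul_mem_mul (Ideal.pow_mem_pow hx k) hm'
    · simp only [map_add, map_mul, map_pow, ← hsm, ← htm]
      ring
  | mul s t _ _ hs ht =>
    obtain ⟨k, m, hm, hsm⟩ := hs
    obtain ⟨l, m', hm', htm⟩ := ht
    refine ⟨k + l, m * m', ?_, ?_⟩
    · rw [pow_add]
      exact Ideal.mul_mem_mul hm hm'
    · rw [map_mul, ← hsm, ← htm]
      ring

/-- Every element of the extension of `I` to `R[𝔪/x]` has the form `j / xᵏ` with `j ∈ I𝔪ᵏ`. -/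
lemma exists_pow_mul_eq_of_mem_map_adjoinMDivX {R : Type*} [CommRing R] [IsLocalRing R] {x : R}
    (hx : x ∈ maximalIdeal R) {I : Ideal R} {s : adjoinMDivX R x}
    (hs : s ∈ I.map (algebraMap R (adjoinMDivX R x))) :
    ∃ k : ℕ, ∃ j ∈ I * maximalIdeal R ^ k,
      algebraMap R (FractionRing R) x ^ k * s = algebraMap R (FractionRing R) j := by
  rw [Ideal.map] at hs
  induction hs using Submodule.span_induction with
  | mem s hs =>
    obtain ⟨i, hi, rfl⟩ := hs
    exact ⟨0, i, by simpa using hi, by rw [pow_zero, one_mul]; rfl⟩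
  | zero => exact ⟨0, 0, zero_mem _, by simp⟩
  | add s t _ _ hs ht =>
    obtain ⟨k, m, hm, hsm⟩ := hs
    obtain ⟨l, m', hm', htm⟩ := ht
    refine ⟨k + l, x ^ l * m + x ^ k * m', add_mem ?_ ?_, ?_⟩
    · rw [add_comm, pow_add, mul_left_comm]
      exact Ideal.mul_mem_mul (Ideal.pow_mem_pow hx l) hm
    · rw [pow_add, mul_left_comm]
      exact Ideal.mul_mem_mul (Ideal.pow_mem_pow hx k) hm'
    · simp only [map_add, map_mul, map_pow, ← hsm, ← htm, Subalgebra.coe_add]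
      ring
  | smul r s _ hs =>
    obtain ⟨k, m, hm, hsm⟩ := exists_pow_mul_eq_of_mem_adjoinMDivX hx r.2
    obtain ⟨l, j, hj, hjs⟩ := hs
    refine ⟨k + l, m * j, ?_, ?_⟩
    · rw [pow_add, mul_left_comm]
      exact Ideal.mul_mem_mul hm hj
    · rw [map_mul, ← hsm, ← hjs, smul_eq_mul, Subalgebra.coe_mul]
      ring

lemma comap_map_adjoinMDivX_eq {R : Type*} [CommRing R] [IsLocalRing R]
    (hreg : IsRegularLocal R) (hdim : ringKrullDim R = 2) {I : Ideal R} {x a : R}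
    (hx : x ∈ maximalIdeal R) (hx2 : x ∉ maximalIdeal R ^ 2) (ha : a ∈ I) {n : ℕ}
    (hn : maximalIdeal R ^ n ≤ I)
    (h : maximalIdeal R * I = Ideal.span {x} * I + Ideal.span {a} * maximalIdeal R) :
    Ideal.comap (algebraMap R (adjoinMDivX R x))
      (Ideal.map (algebraMap R (adjoinMDivX R x)) I) = I := by
  refine le_antisymm (fun z hz ↦ ?_) Ideal.le_comap_map
  obtain ⟨k, j, hj, hjz⟩ := exists_pow_mul_eq_of_mem_map_adjoinMDivX hx hz
  have hjz' : algebraMap R (FractionRing R) (x ^ k * z) = algebraMap R (FractionRing R) j := by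
    rw [← hjz, map_mul, map_pow]
    rfl
  rw [IsFractionRing.injective R (FractionRing R) hjz'.symm] at hj
  clear hjz hjz'
  induction k with
  | zero => simpa using hj
  | succ k ih =>
    refine ih (mem_mul_maximalIdeal_pow_of_mul_mem hreg hdim hx hx2 ha hn h ?_)
    rwa [← mul_assoc, ← pow_succ']

/-- In a two-dimensional regular local ring with infinite residue field,
an `𝔪`-primary ideal is contracted iff it has minimal mixed multiplicity. -/
theorem contracted_iff_minimal_mixed_multiplicity
    (R : Type*) [CommRing R] [IsLocalRing R]
    (hreg : IsRegularLocal R) (hdim : ringKrullDim R = 2)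
    (hres : Infinite (ResidueField R))
    (I : Ideal R) (hI : IsMPrimary R I) :
    IsContracted R I ↔ HasMinimalMixedMultiplicity₂ R I := by
  have := hreg.1
  have hIm : I ≤ maximalIdeal R := hI.2 ▸ Ideal.le_radical
  constructor
  · rintro ⟨x, hx, hx2, hc⟩
    exact hasMinimalMixedMultiplicity_of_comap_map_eq hreg hdim hx hx2 hc
  · rintro ⟨x, a, ⟨hx, ha, -⟩, h⟩
    obtain ⟨n, hn⟩ := Ideal.exists_pow_le_of_le_radical_of_fg hI.2.ge
      (IsNoetherian.noetherian (maximalIdeal R))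
    have hx2 : x ∉ maximalIdeal R ^ 2 := fun hx2 ↦
      notMem_sq_of_maximalIdeal_mul_eq hdim (hIm ha) hn h hx2
    exact ⟨x, hx, hx2, comap_map_adjoinMDivX_eq hreg hdim hx hx2 ha hn h⟩
end

section
/- Let (R, 𝔪) be a local ring, I an ideal of R, and let x ∈ 𝔪 and a ∈ I be such that (x, a) is a regular sequence on R and 𝔪I = xI + a𝔪. Then (𝔪I : x) = I. -/
open IsLocalRing

/-- If `(x, a)` is a regular sequence on `R` and `𝔪I = xI + a𝔪`,
then `(𝔪I : x) = I`. -/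
theorem colon_maximalIdeal_mul_eq
    (R : Type*) [CommRing R] [IsLocalRing R] [IsNoetherianRing R]
    (I : Ideal R) (x a : R) (hx : x ∈ maximalIdeal R) (ha : a ∈ I)
    (hxreg : IsSMulRegular R x)
    (hareg : IsSMulRegular (R ⧸ Ideal.span {x}) a)
    (heq : maximalIdeal R * I = Ideal.span {x} * I + Ideal.span {a} * maximalIdeal R) :
    Submodule.colon (maximalIdeal R * I) (Ideal.span {x}) = I := by
  ext r
  rw [Submodule.mem_colon]
  constructor
  · intro h
    have hrx : r * x ∈ maximalIdeal R * I := h x (Ideal.mem_span_singleton_self x)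
    rw [heq, Submodule.add_eq_sup, Submodule.mem_sup] at hrx
    obtain ⟨_, hy, _, hz, hyz⟩ := hrx
    obtain ⟨i, hi, rfl⟩ := Ideal.mem_span_singleton_mul.mp hy
    obtain ⟨m, -, rfl⟩ := Ideal.mem_span_singleton_mul.mp hz
    have hm : Ideal.Quotient.mk (Ideal.span {x}) m = 0 := by
      apply hareg
      change Ideal.Quotient.mk (Ideal.span {x}) (a * m) = a • 0
      rw [smul_zero, Ideal.Quotient.eq_zero_iff_mem, Ideal.mem_span_singleton]
      exact ⟨r - i, by linear_combination hyz⟩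
    rw [Ideal.Quotient.eq_zero_iff_mem, Ideal.mem_span_singleton] at hm
    obtain ⟨t, rfl⟩ := hm
    have hr : r = i + a * t := by
      apply hxreg
      simp only [smul_eq_mul]
      linear_combination -hyz
    rw [hr]
    exact I.add_mem hi (I.mul_mem_right t ha)
  · intro hr p hp
    rw [smul_eq_mul, mul_comm r p]
    exact Ideal.mul_mem_mul ((Ideal.span_singleton_le_iff_mem _).mpr hx hp) hr
end

section
/- Let (R, 𝔪) be a Cohen–Macaulay local ring of dimension d with infinite residue field and let I be an 𝔪-primary ideal. Suppose x ∈ 𝔪 and a_1, …, a_{d−1} ∈ I satisfy 𝔪I = xI + (a_1, …, a_{d−1})𝔪. Then for every n ≥ 1, (x, a_1, …, a_{d−1})R ∩ 𝔪I^n = xI^n + (a_1, …, a_{d−1})𝔪I^{n−1}. -/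
open IsLocalRing

/-- The depth of a commutative ring `S` with respect to an ideal `J`:
the supremum of lengths of `S`-regular sequences contained in `J`. -/
noncomputable def ringDepth {S : Type*} [CommRing S] (J : Ideal S) : ℕ :=
  sSup {n : ℕ | ∃ rs : List S, rs.length = n ∧ (∀ y ∈ rs, y ∈ J) ∧
    RingTheory.Sequence.IsRegular S rs}

/-- A Noetherian local ring is Cohen–Macaulay if its depth (w.r.t. the maximal ideal)
equals its Krull dimension. -/
def IsCohenMacaulayLocalRing (R : Type*) [CommRing R] [IsLocalRing R] : Prop :=
  (ringDepth (maximalIdeal R) : WithBot ℕ∞) = ringKrullDim R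

/-- If `𝔪I = xI + (a₁,…,a_{d-1})𝔪`, then for every `n ≥ 1`,
`(x, a₁, …, a_{d-1}) ∩ 𝔪Iⁿ = xIⁿ + (a₁,…,a_{d-1})𝔪I^{n-1}`. -/
theorem inter_maximalIdeal_pow_of_minimal_mixed_multiplicity
    (R : Type*) [CommRing R] [IsLocalRing R] [IsNoetherianRing R]
    (d : ℕ) (hdim : ringKrullDim R = d)
    (hCM : IsCohenMacaulayLocalRing R) (hres : Infinite (ResidueField R))
    (I : Ideal R) (hI : IsMPrimary R I)
    (x : R) (a : Fin (d - 1) → R) (hx : x ∈ maximalIdeal R) (ha : ∀ i, a i ∈ I)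
    (heq : maximalIdeal R * I =
      Ideal.span {x} * I + Ideal.span (Set.range a) * maximalIdeal R) :
    ∀ n : ℕ, 1 ≤ n →
      Ideal.span (insert x (Set.range a)) ⊓ (maximalIdeal R * I ^ n) =
        Ideal.span {x} * I ^ n +
          Ideal.span (Set.range a) * (maximalIdeal R * I ^ (n - 1)) := by
  intro n hn
  obtain ⟨k, rfl⟩ := Nat.exists_eq_add_of_le' hn
  have hpow : maximalIdeal R * I ^ (k + 1) =
      Ideal.span {x} * I ^ (k + 1) + Ideal.span (Set.range a) * (maximalIdeal R * I ^ k) := by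
    rw [pow_succ', ← mul_assoc, heq]
    ring
  rw [Nat.add_sub_cancel, ← hpow, inf_eq_right, hpow, Ideal.span_insert]
  exact sup_le_sup Ideal.mul_le_left Ideal.mul_le_left
end

section
/- Let k be a field, let s ≥ 2 be an integer, and in the polynomial ring k[X, Y, Z] let I_s = (Y³, X^{s+1}Y², XY²Z, Y²Z³, X^{2s+1}Y, XYZ², YZ⁵, X^{3s+1}, X²Z, XZ⁴, Z⁷) and J = (X^{3s+1} + Z⁷, X²Z, Y³). Then J·I_s^n = I_s^{n+1} for all n ≥ 2. -/
open MvPolynomial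

theorem Ideal.span_mul_span_le_iff {R : Type*} [CommRing R] {S T : Set R} {K : Ideal R} :
    Ideal.span S * Ideal.span T ≤ K ↔ ∀ x ∈ S, ∀ y ∈ T, x * y ∈ K := by
  rw [Ideal.span_mul_span', Ideal.span_le, Set.mul_subset_iff]
  rfl

open scoped Pointwise in
/-- If `I` is generated by `S`, `p + q ∈ J`, and for every generator `x` one of `p * x`, `q * x`
lies in `J * I`, then adjoining `p` and `q` to `J` does not enlarge `J * I ^ 2`. -/
theorem Ideal.sup_span_pair_mul_sq_le {R : Type*} [CommRing R] {I J : Ideal R} {S : Set R}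
    {p q : R} (hI : I = Ideal.span S) (hpq : p + q ∈ J)
    (h : ∀ x ∈ S, p * x ∈ J * I ∨ q * x ∈ J * I) :
    (J ⊔ Ideal.span {p, q}) * I ^ 2 ≤ J * I ^ 2 := by
  have key : ∀ x ∈ S, ∀ y ∈ S, p * (x * y) ∈ J * I ^ 2 ∧ q * (x * y) ∈ J * I ^ 2 := by
    intro x hx y hy
    have hxI : x ∈ I := hI ▸ Ideal.subset_span hx
    have hyI : y ∈ I := hI ▸ Ideal.subset_span hy
    have hsum : (p + q) * (x * y) ∈ J * I ^ 2 :=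
      Ideal.mul_mem_mul hpq (sq I ▸ Ideal.mul_mem_mul hxI hyI)
    have hmul : ∀ r, r * x ∈ J * I → r * (x * y) ∈ J * I ^ 2 := fun r hr => by
      rw [sq, ← mul_assoc, ← mul_assoc]
      exact Ideal.mul_mem_mul hr hyI
    rcases h x hx with hp | hq
    · refine ⟨hmul p hp, ?_⟩
      convert sub_mem hsum (hmul p hp) using 1
      ring
    · refine ⟨?_, hmul q hq⟩
      convert sub_mem hsum (hmul q hq) using 1
      ring
  rw [Ideal.sup_mul]
  refine sup_le le_rfl ?_
  have hI2 : I ^ 2 = Ideal.span (S * S) := by rw [sq, hI, Ideal.span_mul_span']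
  nth_rewrite 1 [hI2]
  rw [Ideal.span_mul_span_le_iff]
  rintro _ (rfl | rfl) _ ⟨x, hx, y, hy, rfl⟩
  · exact (key x hx y hy).1
  · exact (key x hx y hy).2

open scoped Pointwise in
/-- If all products of two generators of `I` lie in `L * I`, except possibly `u * w`, and for every
generator `z` one of `u * z`, `w * z` lies in `L * I`, then `I ^ 3 ≤ L * I ^ 2`. -/
theorem Ideal.pow_three_le_mul_sq {R : Type*} [CommRing R] {I L : Ideal R} {S : Set R}
    {u w : R} (hI : I = Ideal.span S) (hu : u ∈ I) (hw : w ∈ I)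
    (h : ∀ x ∈ S, ∀ y ∈ S, x * y ∈ L * I ∨ x * y = u * w)
    (huw : ∀ z ∈ S, u * z ∈ L * I ∨ w * z ∈ L * I) :
    I ^ 3 ≤ L * I ^ 2 := by
  have hI3 : I ^ 3 = Ideal.span (S * S) * Ideal.span S := by
    rw [pow_succ, sq, hI, Ideal.span_mul_span']
  rw [hI3, Ideal.span_mul_span_le_iff, sq, ← mul_assoc]
  rintro _ ⟨x, hx, y, hy, rfl⟩ z hz
  have hzI : z ∈ I := hI ▸ Ideal.subset_span hz
  change x * y * z ∈ _
  rcases h x hx y hy with hxy | hxy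
  · exact Ideal.mul_mem_mul hxy hzI
  rw [hxy]
  rcases huw z hz with huz | hwz
  · exact mul_right_comm u z w ▸ Ideal.mul_mem_mul huz hw
  · have := Ideal.mul_mem_mul hwz hu
    rwa [mul_comm (w * z), ← mul_assoc] at this

theorem forall_forall_insert {α : Type*} {P : α → α → Prop} (symm : ∀ a b, P a b → P b a)
    {a : α} {S : Set α} (ha : ∀ b ∈ insert a S, P a b) (hS : ∀ b ∈ S, ∀ c ∈ S, P b c) :
    ∀ b ∈ insert a S, ∀ c ∈ insert a S, P b c := by
  rintro b (rfl | hb) c hc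
  · exact ha c hc
  · rcases hc with rfl | hc
    · exact symm _ _ (ha b (Or.inr hb))
    · exact hS b hb c hc

/-- The cube of the ideal `Iₛ` with `s = t + 2` is contained in `J·Iₛ²`, over any commutative
ring. -/
theorem Ideal.pow_three_le_of_monomial_generators {R : Type*} [CommRing R] (t : ℕ) (x y z : R)
    (I J : Ideal R)
    (hI : I = Ideal.span {y ^ 3, x ^ (t + 2 + 1) * y ^ 2, x * y ^ 2 * z, y ^ 2 * z ^ 3,
      x ^ (2 * (t + 2) + 1) * y, x * y * z ^ 2, y * z ^ 5, x ^ (3 * (t + 2) + 1), x ^ 2 * z,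
      x * z ^ 4, z ^ 7})
    (hJ : J = Ideal.span {x ^ (3 * (t + 2) + 1) + z ^ 7, x ^ 2 * z, y ^ 3}) :
    I ^ 3 ≤ J * I ^ 2 := by
  have ic : y ^ 3 ∈ I := hI ▸ Ideal.subset_span (by simp)
  have iu2 : x ^ (t + 2 + 1) * y ^ 2 ∈ I := hI ▸ Ideal.subset_span (by simp)
  have iu3 : x * y ^ 2 * z ∈ I := hI ▸ Ideal.subset_span (by simp)
  have iu4 : y ^ 2 * z ^ 3 ∈ I := hI ▸ Ideal.subset_span (by simp)
  have iv1 : x ^ (2 * (t + 2) + 1) * y ∈ I := hI ▸ Ideal.subset_span (by simp)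
  have iv2 : x * y * z ^ 2 ∈ I := hI ▸ Ideal.subset_span (by simp)
  have iv3 : y * z ^ 5 ∈ I := hI ▸ Ideal.subset_span (by simp)
  have ip : x ^ (3 * (t + 2) + 1) ∈ I := hI ▸ Ideal.subset_span (by simp)
  have ib : x ^ 2 * z ∈ I := hI ▸ Ideal.subset_span (by simp)
  have iw : x * z ^ 4 ∈ I := hI ▸ Ideal.subset_span (by simp)
  have iq : z ^ 7 ∈ I := hI ▸ Ideal.subset_span (by simp)
  have jb : x ^ 2 * z ∈ J := hJ ▸ Ideal.subset_span (by simp)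
  have jc : y ^ 3 ∈ J := hJ ▸ Ideal.subset_span (by simp)
  have ja : x ^ (3 * (t + 2) + 1) + z ^ 7 ∈ J := hJ ▸ Ideal.subset_span (by simp)
  have mem : ∀ {L : Ideal R} {l g m : R}, l ∈ L → g ∈ I → ∀ r, m = l * (r * g) → m ∈ L * I :=
    fun hl hg r hm => hm ▸ Ideal.mul_mem_mul hl (I.mul_mem_left r hg)
  refine le_trans ?_ (Ideal.sup_span_pair_mul_sq_le hI ja ?_)
  swap
  · have hb := jb
    have hc := jc
    rintro _ (rfl | rfl | rfl | rfl | rfl | rfl | rfl | rfl | rfl | rfl | rfl)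
    · exact Or.inl (mem hc ip 1 (by ring))
    · exact Or.inr (mem hb iu3 (x ^ t * z ^ 5) (by ring))
    · exact Or.inl (mem hb iu2 (x ^ (2 * t + 3)) (by ring))
    · exact Or.inl (mem hb iu2 (x ^ (2 * t + 2) * z ^ 2) (by ring))
    · exact Or.inr (mem hb iv2 (x ^ (2 * t + 2) * z ^ 4) (by ring))
    · exact Or.inl (mem hb iv1 (x ^ (t + 1) * z) (by ring))
    · exact Or.inl (mem hb iv1 (x ^ t * z ^ 4) (by ring))
    · exact Or.inr (mem hb ib (x ^ (3 * t + 3) * z ^ 5) (by ring))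
    · exact Or.inl (mem hb ip 1 (by ring))
    · exact Or.inl (mem hb ib (x ^ (3 * t + 4) * z ^ 2) (by ring))
    · exact Or.inl (mem hb ib (x ^ (3 * t + 3) * z ^ 5) (by ring))
  set L := J ⊔ Ideal.span {x ^ (3 * (t + 2) + 1), z ^ 7}
  have hb : x ^ 2 * z ∈ L := Ideal.mem_sup_left jb
  have hc : y ^ 3 ∈ L := Ideal.mem_sup_left jc
  have hp : x ^ (3 * (t + 2) + 1) ∈ L := Ideal.mem_sup_right (Ideal.subset_span (by simp))
  have hq : z ^ 7 ∈ L := Ideal.mem_sup_right (Ideal.subset_span (by simp))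
  let T : Set R := {x ^ (t + 2 + 1) * y ^ 2, x * y ^ 2 * z, y ^ 2 * z ^ 3,
    x ^ (2 * (t + 2) + 1) * y, x * y * z ^ 2, y * z ^ 5, x * z ^ 4}
  have hT : ∀ a ∈ T, ∀ b ∈ T, a * b ∈ L * I ∨ a * b = y ^ 2 * z ^ 3 * (x * z ^ 4) := by
    have symm : ∀ a b : R, (a * b ∈ L * I ∨ a * b = y ^ 2 * z ^ 3 * (x * z ^ 4)) →
        (b * a ∈ L * I ∨ b * a = y ^ 2 * z ^ 3 * (x * z ^ 4)) :=
      fun a b h => mul_comm a b ▸ h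
    refine forall_forall_insert symm ?_ ?_
    · rintro _ (rfl | rfl | rfl | rfl | rfl | rfl | rfl)
      · exact Or.inl (mem hc iv1 x (by ring))
      · exact Or.inl (mem hb ic (x ^ (t + 2) * y) (by ring))
      · exact Or.inl (mem hb ic (x ^ (t + 1) * y * z ^ 2) (by ring))
      · exact Or.inl (mem hc ip x (by ring))
      · exact Or.inl (mem hb ic (x ^ (t + 2) * z) (by ring))
      · exact Or.inl (mem hb ic (x ^ (t + 1) * z ^ 4) (by ring))
      · exact Or.inl (mem hb iu3 (x ^ (t + 1) * z ^ 2) (by ring))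
    refine forall_forall_insert symm ?_ ?_
    · rintro _ (rfl | rfl | rfl | rfl | rfl | rfl)
      · exact Or.inl (mem hb ic (y * z) (by ring))
      · exact Or.inl (mem hc iv2 (z ^ 2) (by ring))
      · exact Or.inl (mem hb ic (x ^ (2 * t + 4)) (by ring))
      · exact Or.inl (mem hb ic (z ^ 2) (by ring))
      · exact Or.inl (mem hc iw (z ^ 2) (by ring))
      · exact Or.inl (mem hb iu4 z (by ring))
    refine forall_forall_insert symm ?_ ?_
    · rintro _ (rfl | rfl | rfl | rfl | rfl)
      · exact Or.inl (mem hc iv3 z (by ring))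
      · exact Or.inl (mem hb ic (x ^ (2 * t + 3) * z ^ 2) (by ring))
      · exact Or.inl (mem hc iw z (by ring))
      · exact Or.inl (mem hc iq z (by ring))
      · exact Or.inr (by ring)
    refine forall_forall_insert symm ?_ ?_
    · rintro _ (rfl | rfl | rfl | rfl)
      · exact Or.inl (mem hp iu2 1 (by ring))
      · exact Or.inl (mem hb iu2 (x ^ (t + 1) * z) (by ring))
      · exact Or.inl (mem hb iu2 (x ^ t * z ^ 4) (by ring))
      · exact Or.inl (mem hb iv2 (x ^ (2 * t + 3) * z) (by ring))
    refine forall_forall_insert symm ?_ ?_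
    · rintro _ (rfl | rfl | rfl)
      · exact Or.inl (mem hb iu4 1 (by ring))
      · exact Or.inr (by ring)
      · exact Or.inl (mem hb iv3 1 (by ring))
    refine forall_forall_insert symm ?_ ?_
    · rintro _ (rfl | rfl)
      · exact Or.inl (mem hq iu4 1 (by ring))
      · exact Or.inl (mem hq iv2 1 (by ring))
    rintro _ rfl _ rfl
    exact Or.inl (mem hb iq 1 (by ring))
  refine Ideal.pow_three_le_mul_sq hI iu4 iw ?_ ?_
  · have hS : ∀ a ∈ ({y ^ 3, x ^ (t + 2 + 1) * y ^ 2, x * y ^ 2 * z, y ^ 2 * z ^ 3,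
        x ^ (2 * (t + 2) + 1) * y, x * y * z ^ 2, y * z ^ 5, x ^ (3 * (t + 2) + 1), x ^ 2 * z,
        x * z ^ 4, z ^ 7} : Set R), a ∈ I ∧ (a ∈ L ∨ a ∈ T) := by
      intro a ha
      refine ⟨hI ▸ Ideal.subset_span ha, ?_⟩
      rcases ha with rfl | rfl | rfl | rfl | rfl | rfl | rfl | rfl | rfl | rfl | rfl <;>
        first
        | exact Or.inl ‹_›
        | exact Or.inr (by simp [T])
    intro a ha b hb
    obtain ⟨haI, haL | haT⟩ := hS a ha
    · exact Or.inl (Ideal.mul_mem_mul haL (hS b hb).1)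
    obtain ⟨hbI, hbL | hbT⟩ := hS b hb
    · exact Or.inl (mul_comm a b ▸ Ideal.mul_mem_mul hbL haI)
    · exact hT a haT b hbT
  · rintro _ (rfl | rfl | rfl | rfl | rfl | rfl | rfl | rfl | rfl | rfl | rfl)
    · exact Or.inl (mul_comm (y ^ 2 * z ^ 3) _ ▸ Ideal.mul_mem_mul hc iu4)
    · exact Or.inl (mem hb ic (x ^ (t + 1) * y * z ^ 2) (by ring))
    · exact Or.inl (mem hc iv2 (z ^ 2) (by ring))
    · exact Or.inl (mem hc iv3 z (by ring))
    · exact Or.inl (mem hb ic (x ^ (2 * t + 3) * z ^ 2) (by ring))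
    · exact Or.inl (mem hc iw z (by ring))
    · exact Or.inl (mem hc iq z (by ring))
    · exact Or.inl (mul_comm (y ^ 2 * z ^ 3) _ ▸ Ideal.mul_mem_mul hp iu4)
    · exact Or.inl (mul_comm (y ^ 2 * z ^ 3) _ ▸ Ideal.mul_mem_mul hb iu4)
    · exact Or.inr (mem hb iq 1 (by ring))
    · exact Or.inl (mul_comm (y ^ 2 * z ^ 3) _ ▸ Ideal.mul_mem_mul hq iu4)

/-- For `s ≥ 2`, with
`Iₛ = (Y³, X^{s+1}Y², XY²Z, Y²Z³, X^{2s+1}Y, XYZ², YZ⁵, X^{3s+1}, X²Z, XZ⁴, Z⁷)` and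
`J = (X^{3s+1} + Z⁷, X²Z, Y³)` in `k[X, Y, Z]`, one has `J·Iₛⁿ = Iₛⁿ⁺¹` for all `n ≥ 2`. -/
theorem J_mul_pow_eq_pow_succ
    (k : Type*) [Field k] (s : ℕ) (hs : 2 ≤ s)
    (X Y Z : MvPolynomial (Fin 3) k)
    (hX : X = MvPolynomial.X 0) (hY : Y = MvPolynomial.X 1) (hZ : Z = MvPolynomial.X 2)
    (I J : Ideal (MvPolynomial (Fin 3) k))
    (hI : I = Ideal.span {Y ^ 3, X ^ (s + 1) * Y ^ 2, X * Y ^ 2 * Z, Y ^ 2 * Z ^ 3,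
      X ^ (2 * s + 1) * Y, X * Y * Z ^ 2, Y * Z ^ 5, X ^ (3 * s + 1), X ^ 2 * Z,
      X * Z ^ 4, Z ^ 7})
    (hJ : J = Ideal.span {X ^ (3 * s + 1) + Z ^ 7, X ^ 2 * Z, Y ^ 3}) :
    ∀ n : ℕ, 2 ≤ n → J * I ^ n = I ^ (n + 1) := by
  intro n hn
  obtain ⟨t, rfl⟩ := Nat.exists_eq_add_of_le' hs
  obtain ⟨m, rfl⟩ := Nat.exists_eq_add_of_le' hn
  have hJI : J ≤ I := by
    have hp : X ^ (3 * (t + 2) + 1) ∈ I := hI ▸ Ideal.subset_span (by simp)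
    have hq : Z ^ 7 ∈ I := hI ▸ Ideal.subset_span (by simp)
    rw [hJ, Ideal.span_le]
    rintro _ (rfl | rfl | rfl)
    · exact add_mem hp hq
    · exact hI ▸ Ideal.subset_span (by simp)
    · exact hI ▸ Ideal.subset_span (by simp)
  refine le_antisymm ?_ ?_
  · exact (Ideal.mul_mono_left hJI).trans_eq (pow_succ' I (m + 2)).symm
  · calc I ^ (m + 2 + 1) = I ^ 3 * I ^ m := by ring
      _ ≤ J * I ^ 2 * I ^ m :=
        Ideal.mul_mono_left (Ideal.pow_three_le_of_monomial_generators t X Y Z I J hI hJ)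
      _ = J * I ^ (m + 2) := by ring
end

section
/- Let k be a field, let s ≥ 2 be an integer, and in the polynomial ring k[X, Y, Z] let I_s = (Y³, X^{s+1}Y², XY²Z, Y²Z³, X^{2s+1}Y, XYZ², YZ⁵, X^{3s+1}, X²Z, XZ⁴, Z⁷) and J = (X^{3s+1} + Z⁷, X²Z, Y³). Then J ∩ I_s² = J·I_s. -/
open MvPolynomial

section MonomialIdeals

variable {σ k : Type*} [Field k]

/-- The square of a monomial ideal is generated by the pairwise products of the generators. -/
theorem exists_add_le_of_mem_sq_span_monomial {G : Set (σ →₀ ℕ)} {u : MvPolynomial σ k}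
    (hu : u ∈ Ideal.span ((fun d => monomial d (1 : k)) '' G) ^ 2)
    {e : σ →₀ ℕ} (he : coeff e u ≠ 0) : ∃ p ∈ G, ∃ q ∈ G, p + q ≤ e := by
  have hsq : Ideal.span ((fun d => monomial d (1 : k)) '' G) ^ 2 ≤
      Ideal.span ((fun d => monomial d (1 : k)) '' Set.image2 (· + ·) G G) := by
    rw [pow_two, Ideal.span_mul_span', Ideal.span_le]
    rintro _ ⟨_, ⟨p, hp, rfl⟩, _, ⟨q, hq, rfl⟩, rfl⟩
    exact Ideal.subset_span ⟨p + q, ⟨p, hp, q, hq, rfl⟩, by simp [monomial_mul]⟩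
  obtain ⟨_, ⟨p, hp, q, hq, rfl⟩, hle⟩ :=
    mem_ideal_span_monomial_image.1 (hsq hu) e (mem_support_iff.2 he)
  exact ⟨p, hp, q, hq, hle⟩

/-- Every polynomial is congruent, modulo a monomial ideal, to one supported outside the ideal. -/
theorem exists_sub_mem_span_monomial (G : Set (σ →₀ ℕ)) (a : MvPolynomial σ k) :
    ∃ b, a - b ∈ Ideal.span ((fun d => monomial d (1 : k)) '' G) ∧
      ∀ d, coeff d b ≠ 0 → ∀ g ∈ G, ¬ g ≤ d := by
  classical
  induction a using MvPolynomial.induction_on' with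
  | monomial m r =>
    by_cases hm : ∃ g ∈ G, g ≤ m
    · refine ⟨0, mem_ideal_span_monomial_image.2 fun d hd => ?_, by simp⟩
      rw [sub_zero] at hd
      rwa [Finset.mem_singleton.1 (support_monomial_subset hd)]
    · push Not at hm
      refine ⟨monomial m r, by simp, fun d hd => ?_⟩
      have : m = d := by
        by_contra h
        exact hd (by rw [coeff_monomial, if_neg h])
      exact this ▸ hm
  | add p q hp hq =>
    obtain ⟨b, hb, hb'⟩ := hp
    obtain ⟨c, hc, hc'⟩ := hq
    refine ⟨b + c, by simpa only [add_sub_add_comm] using add_mem hb hc, fun d hd => ?_⟩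
    by_cases h : coeff d b = 0
    · exact hc' d (by simpa [h] using hd)
    · exact hb' d h

end MonomialIdeals

/-- The exponent of the monomial `X ^ a * Y ^ b * Z ^ c`. -/
noncomputable def exponent (a b c : ℕ) : Fin 3 →₀ ℕ :=
  Finsupp.single 0 a + Finsupp.single 1 b + Finsupp.single 2 c

@[simp] theorem exponent_zero (a b c : ℕ) : exponent a b c 0 = a := by simp [exponent]

@[simp] theorem exponent_one (a b c : ℕ) : exponent a b c 1 = b := by simp [exponent]

@[simp] theorem exponent_two (a b c : ℕ) : exponent a b c 2 = c := by simp [exponent]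

theorem monomial_exponent (k : Type*) [Field k] (a b c : ℕ) :
    monomial (exponent a b c) (1 : k) = X 0 ^ a * X 1 ^ b * X 2 ^ c := by
  simp [exponent, X_pow_eq_monomial, monomial_mul]

theorem fin_three_finsupp_le_iff {p q : Fin 3 →₀ ℕ} :
    p ≤ q ↔ p 0 ≤ q 0 ∧ p 1 ≤ q 1 ∧ p 2 ≤ q 2 := by
  rw [Finsupp.le_def, Fin.forall_fin_succ, Fin.forall_fin_succ, Fin.forall_fin_succ]
  simp

/-- The exponents of the monomial generators of `Iₛ`. -/
def generatorExponents (s : ℕ) : Set (Fin 3 →₀ ℕ) :=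
  {exponent 0 3 0, exponent (s + 1) 2 0, exponent 1 2 1, exponent 0 2 3,
    exponent (2 * s + 1) 1 0, exponent 1 1 2, exponent 0 1 5, exponent (3 * s + 1) 0 0,
    exponent 2 0 1, exponent 1 0 4, exponent 0 0 7}

/-- The exponents of the monomials outside `Iₛ`. -/
def IsStandard (s : ℕ) (d : Fin 3 →₀ ℕ) : Prop :=
  (d 1 = 0 ∧ d 2 = 0 ∧ d 0 ≤ 3 * s) ∨ (d 1 = 0 ∧ d 0 = 1 ∧ d 2 ≤ 3) ∨
  (d 1 = 0 ∧ d 0 = 0 ∧ d 2 ≤ 6) ∨ (d 1 = 1 ∧ d 2 = 0 ∧ d 0 ≤ 2 * s) ∨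
  (d 1 = 1 ∧ d 0 = 1 ∧ d 2 = 1) ∨ (d 1 = 1 ∧ d 0 = 0 ∧ d 2 ≤ 4) ∨
  (d 1 = 2 ∧ d 2 = 0 ∧ d 0 ≤ s) ∨ (d 1 = 2 ∧ d 0 = 0 ∧ d 2 ≤ 2)

theorem isStandard_of_forall_not_le {s : ℕ} {d : Fin 3 →₀ ℕ}
    (hd : ∀ g ∈ generatorExponents s, ¬ g ≤ d) : IsStandard s d := by
  simp only [generatorExponents, Set.mem_insert_iff, Set.mem_singleton_iff, forall_eq_or_imp,
    forall_eq, fin_three_finsupp_le_iff, exponent_zero, exponent_one, exponent_two] at hd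
  obtain ⟨h1, h2, h3, h4, h5, h6, h7, h8, h9, h10, h11⟩ := hd
  unfold IsStandard
  generalize d 0 = x at *
  generalize d 1 = y at *
  generalize d 2 = z at *
  have hx : x = 0 ∨ x = 1 ∨ 2 ≤ x := by omega
  have hy : y = 0 ∨ y = 1 ∨ y = 2 := by omega
  rcases hy with rfl | rfl | rfl <;> rcases hx with rfl | rfl | hx <;> simp at * <;> omega

set_option maxHeartbeats 2000000 in
/-- If `m` lies outside `Iₛ` then `Y³ m` lies outside `Iₛ²`, and so does `X²Z m`, as well as
`X ^ (3s + 1) m` if `Z` does not divide `m` and `Z ^ 7 m` if it does. -/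
theorem IsStandard.not_add_le {s : ℕ} (hs : 2 ≤ s) {m t p q : Fin 3 →₀ ℕ}
    (hm : IsStandard s m)
    (ht : t = exponent 0 3 0 ∨ t = exponent 2 0 1 ∨ (m 2 = 0 ∧ t = exponent (3 * s + 1) 0 0) ∨
      (m 2 ≠ 0 ∧ t = exponent 0 0 7))
    (hp : p ∈ generatorExponents s) (hq : q ∈ generatorExponents s) : ¬ p + q ≤ m + t := by
  rw [fin_three_finsupp_le_iff]
  simp only [Finsupp.add_apply]
  unfold IsStandard at hm
  simp only [generatorExponents, Set.mem_insert_iff, Set.mem_singleton_iff] at hp hq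
  generalize m 0 = x at *
  generalize m 1 = y at *
  generalize m 2 = z at *
  rcases ht with rfl | rfl | ⟨hz, rfl⟩ | ⟨hz, rfl⟩ <;>
  rcases hp with rfl | rfl | rfl | rfl | rfl | rfl | rfl | rfl | rfl | rfl | rfl <;>
  rcases hq with rfl | rfl | rfl | rfl | rfl | rfl | rfl | rfl | rfl | rfl | rfl <;>
  simp only [exponent_zero, exponent_one, exponent_two] <;> omega

/-- A coefficient of `a * M`, for a monomial `M` and for `a` supported outside `Iₛ`, vanishes
unless `M` times a monomial outside `Iₛ` has that exponent. -/
theorem coeff_mul_monomial_eq_zero {k : Type*} [Field k] {s : ℕ} {a : MvPolynomial (Fin 3) k}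
    (ha : ∀ d, coeff d a ≠ 0 → IsStandard s d) (e t : Fin 3 →₀ ℕ)
    (h : ∀ d, IsStandard s d → e 0 = d 0 + t 0 → e 1 = d 1 + t 1 → e 2 = d 2 + t 2 → False) :
    coeff e (a * monomial t 1) = 0 := by
  rw [coeff_mul_monomial']
  split_ifs with hle
  · by_contra hne
    have hd := tsub_add_cancel_of_le hle
    have hc (i) : e i = (e - t) i + t i := by rw [← Finsupp.add_apply, hd]
    exact h (e - t) (ha _ (by simpa using hne)) (hc 0) (hc 1) (hc 2)
  · rfl

/-- The three generators of `J` are independent modulo `Iₛ²` over polynomials supported outside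
`Iₛ`. -/
theorem eq_zero_of_mem_sq {k : Type*} [Field k] {s : ℕ} (hs : 2 ≤ s)
    {a b c : MvPolynomial (Fin 3) k}
    (ha : ∀ d, coeff d a ≠ 0 → IsStandard s d) (hb : ∀ d, coeff d b ≠ 0 → IsStandard s d)
    (hc : ∀ d, coeff d c ≠ 0 → IsStandard s d)
    (hu : a * monomial (exponent (3 * s + 1) 0 0) 1 + a * monomial (exponent 0 0 7) 1 +
      b * monomial (exponent 2 0 1) 1 + c * monomial (exponent 0 3 0) 1 ∈
      Ideal.span ((fun d => monomial d (1 : k)) '' generatorExponents s) ^ 2) :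
    a = 0 ∧ b = 0 ∧ c = 0 := by
  have hcoeff {m t} (hm : IsStandard s m)
      (ht : t = exponent 0 3 0 ∨ t = exponent 2 0 1 ∨
        (m 2 = 0 ∧ t = exponent (3 * s + 1) 0 0) ∨ (m 2 ≠ 0 ∧ t = exponent 0 0 7)) :
      coeff (m + t) (a * monomial (exponent (3 * s + 1) 0 0) 1) +
        coeff (m + t) (a * monomial (exponent 0 0 7) 1) +
        coeff (m + t) (b * monomial (exponent 2 0 1) 1) +
        coeff (m + t) (c * monomial (exponent 0 3 0) 1) = 0 := by
    by_contra hne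
    obtain ⟨p, hp, q, hq, hle⟩ := exists_add_le_of_mem_sq_span_monomial hu
      (e := m + t) (by simpa only [coeff_add] using hne)
    exact hm.not_add_le hs ht hp hq hle
  have ha0 : a = 0 := by
    ext m
    rw [coeff_zero]
    by_contra hne
    have hm := ha m hne
    by_cases hz : m 2 = 0
    · have h := hcoeff hm (Or.inr (Or.inr (Or.inl ⟨hz, rfl⟩)))
      rw [coeff_mul_monomial, coeff_mul_monomial_eq_zero ha, coeff_mul_monomial_eq_zero hb,
        coeff_mul_monomial_eq_zero hc] at h
      · simp_all
      all_goals
        intro d hd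
        simp only [Finsupp.add_apply, exponent_zero, exponent_one, exponent_two]
        unfold IsStandard at hd hm
        omega
    · have h := hcoeff hm (Or.inr (Or.inr (Or.inr ⟨hz, rfl⟩)))
      rw [coeff_mul_monomial, coeff_mul_monomial_eq_zero ha, coeff_mul_monomial_eq_zero hb,
        coeff_mul_monomial_eq_zero hc] at h
      · simp_all
      all_goals
        intro d hd
        simp only [Finsupp.add_apply, exponent_zero, exponent_one, exponent_two]
        unfold IsStandard at hd hm
        omega
  have hc0 : c = 0 := by
    ext m
    rw [coeff_zero]
    by_contra hne
    have hm := hc m hne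
    have h := hcoeff hm (Or.inl rfl)
    rw [coeff_mul_monomial, coeff_mul_monomial_eq_zero hb, ha0] at h
    · simp_all
    · intro d hd
      simp only [Finsupp.add_apply, exponent_zero, exponent_one, exponent_two]
      unfold IsStandard at hd hm
      omega
  refine ⟨ha0, ?_, hc0⟩
  ext m
  rw [coeff_zero]
  by_contra hne
  have h := hcoeff (hb m hne) (Or.inr (Or.inl rfl))
  rw [coeff_mul_monomial, ha0, hc0] at h
  simp_all

/-- For `s ≥ 2`, with
`Iₛ = (Y³, X^{s+1}Y², XY²Z, Y²Z³, X^{2s+1}Y, XYZ², YZ⁵, X^{3s+1}, X²Z, XZ⁴, Z⁷)` and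
`J = (X^{3s+1} + Z⁷, X²Z, Y³)` in `k[X, Y, Z]`, one has `J ∩ Iₛ² = J·Iₛ`. -/
theorem J_inter_sq_eq_J_mul
    (k : Type*) [Field k] (s : ℕ) (hs : 2 ≤ s)
    (X Y Z : MvPolynomial (Fin 3) k)
    (hX : X = MvPolynomial.X 0) (hY : Y = MvPolynomial.X 1) (hZ : Z = MvPolynomial.X 2)
    (I J : Ideal (MvPolynomial (Fin 3) k))
    (hI : I = Ideal.span {Y ^ 3, X ^ (s + 1) * Y ^ 2, X * Y ^ 2 * Z, Y ^ 2 * Z ^ 3,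
      X ^ (2 * s + 1) * Y, X * Y * Z ^ 2, Y * Z ^ 5, X ^ (3 * s + 1), X ^ 2 * Z,
      X * Z ^ 4, Z ^ 7})
    (hJ : J = Ideal.span {X ^ (3 * s + 1) + Z ^ 7, X ^ 2 * Z, Y ^ 3}) :
    J ⊓ I ^ 2 = J * I := by
  have hIG : I = Ideal.span ((fun d => monomial d (1 : k)) '' generatorExponents s) := by
    simp only [hI, generatorExponents, Set.image_insert_eq, Set.image_singleton,
      monomial_exponent, ← hX, ← hY, ← hZ, pow_zero, pow_one, one_mul, mul_one]
  have hfJ : X ^ (3 * s + 1) + Z ^ 7 ∈ J := hJ ▸ Ideal.subset_span (by simp)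
  have hgJ : X ^ 2 * Z ∈ J := hJ ▸ Ideal.subset_span (by simp)
  have hhJ : Y ^ 3 ∈ J := hJ ▸ Ideal.subset_span (by simp)
  have hJI : J ≤ I := by
    rw [hJ, Ideal.span_le]
    rintro _ (rfl | rfl | rfl)
    · exact add_mem (hI ▸ Ideal.subset_span (by simp)) (hI ▸ Ideal.subset_span (by simp))
    · exact hI ▸ Ideal.subset_span (by simp)
    · exact hI ▸ Ideal.subset_span (by simp)
  refine le_antisymm ?_ (le_inf Ideal.mul_le_left (pow_two I ▸ Ideal.mul_mono_left hJI))
  rintro u ⟨huJ, huI⟩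
  obtain ⟨a, b, c, rfl⟩ : ∃ a b c, a * (X ^ (3 * s + 1) + Z ^ 7) + b * (X ^ 2 * Z) + c * Y ^ 3
      = u := by
    have huJ : u ∈ J := huJ
    simp only [hJ, Ideal.mem_span_insert, Ideal.mem_span_singleton'] at huJ
    obtain ⟨a, _, ⟨b, _, ⟨c, rfl⟩, rfl⟩, rfl⟩ := huJ
    exact ⟨a, b, c, by ring⟩
  obtain ⟨a', haI, ha⟩ := exists_sub_mem_span_monomial (generatorExponents s) a
  obtain ⟨b', hbI, hb⟩ := exists_sub_mem_span_monomial (generatorExponents s) b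
  obtain ⟨c', hcI, hc⟩ := exists_sub_mem_span_monomial (generatorExponents s) c
  rw [← hIG] at haI hbI hcI
  have hdiff : (X ^ (3 * s + 1) + Z ^ 7) * (a - a') + (X ^ 2 * Z) * (b - b') + Y ^ 3 * (c - c')
      ∈ J * I :=
    add_mem (add_mem (Ideal.mul_mem_mul hfJ haI) (Ideal.mul_mem_mul hgJ hbI))
      (Ideal.mul_mem_mul hhJ hcI)
  have hred := sub_mem (show _ ∈ I ^ 2 from huI)
    ((pow_two I ▸ Ideal.mul_mono_left hJI : J * I ≤ I ^ 2) hdiff)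
  obtain ⟨rfl, rfl, rfl⟩ := eq_zero_of_mem_sq (k := k) hs (a := a') (b := b') (c := c')
    (fun d hd => isStandard_of_forall_not_le (ha d hd))
    (fun d hd => isStandard_of_forall_not_le (hb d hd))
    (fun d hd => isStandard_of_forall_not_le (hc d hd)) (by
      rw [← hIG]
      convert hred using 1
      simp only [monomial_exponent, ← hX, ← hY, ← hZ, pow_zero, pow_one, one_mul, mul_one]
      ring)
  convert hdiff using 1
  ring
end

section
/- Let k be a field and n ≥ 4 an integer. In the polynomial ring k[X, Y] let I = (X^n, X²Y^{n−2}, XY^{n−1}, Y^n) and J = (X^n, Y^n). Then X³Y^{2n−3} ∈ J ∩ I² but X³Y^{2n−3} ∉ J·I. In particular J ∩ I² ≠ J·I. -/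
/-- The monomial `X_i ^ a * X_j ^ b` with `a < c`, `b < d` and `i ≠ j` does not lie in
`(X_i ^ c, X_j ^ d)`. -/
theorem MvPolynomial.X_pow_mul_X_pow_notMem_span_pair {σ R : Type*} [CommRing R] [Nontrivial R]
    {i j : σ} (hij : i ≠ j) {a b c d : ℕ} (hac : a < c) (hbd : b < d) :
    (X i ^ a * X j ^ b : MvPolynomial σ R) ∉ Ideal.span {X i ^ c, X j ^ d} := by
  have hspan : ({X i ^ c, X j ^ d} : Set (MvPolynomial σ R)) =
      (fun s => monomial s (1 : R)) '' {Finsupp.single i c, Finsupp.single j d} := by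
    simp [Set.image_pair, X_pow_eq_monomial]
  classical
  rw [hspan, mem_ideal_span_monomial_image, X_pow_eq_monomial, X_pow_eq_monomial, monomial_mul,
    mul_one]
  intro h
  obtain ⟨s, hs, hle⟩ := h (Finsupp.single i a + Finsupp.single j b) (by simp)
  rcases hs with rfl | rfl
  · have := hle i
    simp [hij.symm] at this
    omega
  · have := hle j
    simp [hij] at this
    omega

/-- For `n ≥ 4`, with `I = (Xⁿ, X²Y^{n-2}, XY^{n-1}, Yⁿ)` and
`J = (Xⁿ, Yⁿ)` in `k[X,Y]`, one has `X³Y^{2n-3} ∈ J ∩ I²` but `X³Y^{2n-3} ∉ J·I`;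
in particular `J ∩ I² ≠ J·I`. -/
theorem mem_inter_not_mem_mul
    (k : Type*) [Field k] (n : ℕ) (hn : 4 ≤ n)
    (X Y : MvPolynomial (Fin 2) k)
    (hX : X = MvPolynomial.X 0) (hY : Y = MvPolynomial.X 1)
    (I J : Ideal (MvPolynomial (Fin 2) k))
    (hI : I = Ideal.span {X ^ n, X ^ 2 * Y ^ (n - 2), X * Y ^ (n - 1), Y ^ n})
    (hJ : J = Ideal.span {X ^ n, Y ^ n}) :
    X ^ 3 * Y ^ (2 * n - 3) ∈ J ⊓ I ^ 2 ∧
      X ^ 3 * Y ^ (2 * n - 3) ∉ J * I ∧ J ⊓ I ^ 2 ≠ J * I := by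
  have hmul : X ^ 3 * Y ^ (2 * n - 3) ∈ J ⊓ I ^ 2 := by
    refine ⟨?_, ?_⟩
    · rw [hJ, show 2 * n - 3 = (n - 3) + n by omega, pow_add, ← mul_assoc]
      exact Ideal.mul_mem_left _ _ (Ideal.subset_span (by simp))
    · rw [show X ^ 3 * Y ^ (2 * n - 3) = (X ^ 2 * Y ^ (n - 2)) * (X * Y ^ (n - 1)) by
        rw [show 2 * n - 3 = (n - 2) + (n - 1) by omega]; ring, pow_two, hI]
      exact Ideal.mul_mem_mul (Ideal.subset_span (by simp)) (Ideal.subset_span (by simp))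
  have hle : J * I ≤ Ideal.span {X ^ 4, Y ^ (2 * n - 2)} := by
    have hXmem (p : MvPolynomial (Fin 2) k) :
        X ^ n * p ∈ Ideal.span {X ^ 4, Y ^ (2 * n - 2)} :=
      Ideal.mul_mem_right _ _ (Ideal.mem_of_dvd _ (pow_dvd_pow X hn)
        (Ideal.subset_span (by simp)))
    have hYmem (p : MvPolynomial (Fin 2) k) {m : ℕ} (hm : n - 2 ≤ m) :
        Y ^ n * (p * Y ^ m) ∈ Ideal.span {X ^ 4, Y ^ (2 * n - 2)} := by
      rw [mul_left_comm, ← pow_add]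
      exact Ideal.mul_mem_left _ _ (Ideal.mem_of_dvd _
        (pow_dvd_pow Y (show 2 * n - 2 ≤ n + m by omega)) (Ideal.subset_span (by simp)))
    rw [hJ, hI, Ideal.span_mul_span', Ideal.span_le]
    rintro _ ⟨f, hf, g, hg, rfl⟩
    rcases hf with rfl | rfl
    · exact hXmem g
    · rcases hg with rfl | rfl | rfl | rfl
      · simpa only [mul_comm, SetLike.mem_coe] using hXmem (Y ^ n)
      · exact hYmem _ le_rfl
      · exact hYmem _ (by omega)
      · simpa using hYmem 1 (Nat.sub_le n 2)
  have hnot : X ^ 3 * Y ^ (2 * n - 3) ∉ J * I := fun h => by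
    have hmem := hle h
    rw [hX, hY] at hmem
    exact MvPolynomial.X_pow_mul_X_pow_notMem_span_pair (by decide) (by omega) (by omega) hmem
  exact ⟨hmul, hnot, fun h => hnot (h ▸ hmul)⟩
end

section
/- Let k be a field and n ≥ 4 an integer. In the polynomial ring k[X, Y] let I = (X^n, X²Y^{n−2}, XY^{n−1}, Y^n), J = (X^n, Y^n), and r = ⌊n/2⌋. Then J·I^r = I^{r+1}. -/
/-- Modulo `(a, d) * (a, b, c, d) ^ m`, the power `(a, b, c, d) ^ (m + 1)` is generated by
`b ^ (m + 1)` and `b ^ m * c` as soon as `c ^ 2 = b * d`. -/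
theorem Ideal.span_pow_succ_le_of_sq_eq_mul {R : Type*} [CommRing R] {a b c d : R}
    (h : c ^ 2 = b * d) (m : ℕ) :
    Ideal.span {a, b, c, d} ^ (m + 1) ≤
      Ideal.span {a, d} * Ideal.span {a, b, c, d} ^ m ⊔ Ideal.span {b ^ (m + 1), b ^ m * c} := by
  induction m with
  | zero =>
    simp only [zero_add, pow_one, pow_zero, Ideal.one_eq_top, Ideal.mul_top, one_mul,
      ← Ideal.span_union]
    exact Ideal.span_mono (by grind)
  | succ m ih =>
    set I : Ideal R := Ideal.span {a, b, c, d} with hI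
    set J : Ideal R := Ideal.span {a, d} with hJ
    have ha : a ∈ J := Ideal.subset_span (by simp)
    have hd : d ∈ J := Ideal.subset_span (by simp)
    have hb : b ∈ I := Ideal.subset_span (by simp)
    have hc : c ∈ I := Ideal.subset_span (by simp)
    have hbm : b ^ (m + 1) ∈ I ^ (m + 1) := Ideal.pow_mem_pow hb _
    have hbc : b ^ m * c ∈ I ^ (m + 1) := by
      rw [pow_succ]
      exact Ideal.mul_mem_mul (Ideal.pow_mem_pow hb _) hc
    have of_J {x y : R} (hx : x ∈ I ^ (m + 1)) (hy : y ∈ J) :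
        x * y ∈ J * I ^ (m + 1) ⊔ Ideal.span {b ^ (m + 1 + 1), b ^ (m + 1) * c} :=
      Ideal.mem_sup_left (mul_comm x y ▸ Ideal.mul_mem_mul hy hx)
    rw [pow_succ]
    refine (Ideal.mul_mono_left ih).trans ?_
    rw [Ideal.sup_mul]
    refine sup_le ?_ ?_
    · rw [mul_assoc, ← pow_succ]
      exact le_sup_left
    · conv_lhs => rw [hI]
      rw [Ideal.span_mul_span', Ideal.span_le]
      rintro _ ⟨x, hx, y, hy, rfl⟩
      simp only [Set.mem_insert_iff, Set.mem_singleton_iff] at hx hy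
      have hxI : x ∈ I ^ (m + 1) := by
        rcases hx with rfl | rfl <;> assumption
      rcases hy with rfl | rfl | rfl | rfl
      · exact of_J hxI ha
      · refine Ideal.mem_sup_right (Ideal.subset_span ?_)
        rcases hx with rfl | rfl
        · left; ring
        · right; simp only [Set.mem_singleton_iff]; ring
      · rcases hx with rfl | rfl
        · exact Ideal.mem_sup_right (Ideal.subset_span (by simp))
        · have : b ^ m * y * y = b ^ (m + 1) * d := by
            rw [mul_assoc, ← sq, h]; ring
          simpa only [SetLike.mem_coe, this] using of_J hbm hd
      · exact of_J hxI hd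

/-- For `n ≥ 4`, with `I = (Xⁿ, X²Y^{n-2}, XY^{n-1}, Yⁿ)`,
`J = (Xⁿ, Yⁿ)` and `r = ⌊n/2⌋`, one has `J·I^r = I^{r+1}`. -/
theorem J_mul_pow_floor_eq
    (k : Type*) [Field k] (n : ℕ) (hn : 4 ≤ n)
    (X Y : MvPolynomial (Fin 2) k)
    (hX : X = MvPolynomial.X 0) (hY : Y = MvPolynomial.X 1)
    (I J : Ideal (MvPolynomial (Fin 2) k))
    (hI : I = Ideal.span {X ^ n, X ^ 2 * Y ^ (n - 2), X * Y ^ (n - 1), Y ^ n})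
    (hJ : J = Ideal.span {X ^ n, Y ^ n})
    (r : ℕ) (hr : r = n / 2) :
    J * I ^ r = I ^ (r + 1) := by
  have hJI : J ≤ I := by
    rw [hI, hJ]
    exact Ideal.span_mono (by grind)
  have ha : X ^ n ∈ J := hJ ▸ Ideal.subset_span (by simp)
  have hb : X ^ 2 * Y ^ (n - 2) ∈ I := hI ▸ Ideal.subset_span (by simp)
  have hc : X * Y ^ (n - 1) ∈ I := hI ▸ Ideal.subset_span (by simp)
  have hd : Y ^ n ∈ I := hI ▸ Ideal.subset_span (by simp)
  obtain ⟨s, rfl⟩ : ∃ s, r = s + 1 := ⟨r - 1, by omega⟩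
  have of_mem {x : MvPolynomial (Fin 2) k} (hx : x ∈ I) :
      X ^ n * ((Y ^ n) ^ s * x) ∈ J * I ^ (s + 1) := by
    rw [pow_succ]
    exact Ideal.mul_mem_mul ha (Ideal.mul_mem_mul (Ideal.pow_mem_pow hd s) hx)
  refine le_antisymm ?_ ?_
  · rw [pow_succ' I (s + 1)]
    exact Ideal.mul_mono_left hJI
  have hsq : (X * Y ^ (n - 1)) ^ 2 = X ^ 2 * Y ^ (n - 2) * Y ^ n := by
    obtain ⟨t, rfl⟩ : ∃ t, n = t + 2 := ⟨n - 2, by omega⟩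
    simp only [Nat.add_sub_cancel, show t + 2 - 1 = t + 1 by omega]
    ring
  have key := Ideal.span_pow_succ_le_of_sq_eq_mul (a := X ^ n) hsq (s + 1)
  rw [← hI, ← hJ] at key
  refine key.trans (sup_le le_rfl ?_)
  rw [Ideal.span_le]
  rcases Nat.even_or_odd' n with ⟨t, ht | ht⟩
  · obtain rfl : n = 2 * s + 2 := by omega
    have hpow : (X ^ 2 * Y ^ (2 * s + 2 - 2)) ^ (s + 1) =
        X ^ (2 * s + 2) * (Y ^ (2 * s + 2)) ^ s := by
      simp only [Nat.add_sub_cancel]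
      ring
    rintro _ (rfl | rfl)
    · rw [pow_succ _ (s + 1), hpow, mul_assoc]
      exact of_mem hb
    · rw [hpow, mul_assoc]
      exact of_mem hc
  · obtain rfl : n = 2 * s + 3 := by omega
    simp only [show 2 * s + 3 - 2 = 2 * s + 1 by omega, show 2 * s + 3 - 1 = 2 * s + 2 by omega]
      at hc ⊢
    rintro _ (rfl | rfl)
    · rw [SetLike.mem_coe]
      convert of_mem hc using 1
      ring
    · rw [SetLike.mem_coe]
      convert of_mem hd using 1
      ring
end

section
/- Let k be a field and n ≥ 4 an integer. The k-subalgebra A = k[X^n, X²Y^{n−2}, XY^{n−1}, Y^n] of the polynomial ring k[X, Y] is Cohen–Macaulay; moreover, if n is even then A is Gorenstein. -/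
open IsLocalRing

/-- A Noetherian ring is Cohen–Macaulay if all its localizations at primes are
Cohen–Macaulay local rings. -/
def IsCohenMacaulayRing (S : Type*) [CommRing S] : Prop :=
  IsNoetherianRing S ∧
    ∀ (P : Ideal S) [P.IsPrime], IsCohenMacaulayLocalRing (Localization.AtPrime P)

/-- A Noetherian local ring is Gorenstein if it is Cohen–Macaulay and some maximal
regular sequence (a system of parameters) generates an irreducible ideal. -/
def IsGorensteinLocalRing (R : Type*) [CommRing R] [IsLocalRing R] : Prop :=
  IsCohenMacaulayLocalRing R ∧
    ∃ rs : List R, (∀ y ∈ rs, y ∈ maximalIdeal R) ∧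
      RingTheory.Sequence.IsRegular R rs ∧
      (rs.length : WithBot ℕ∞) = ringKrullDim R ∧
      ∀ J K : Ideal R, Ideal.span {y | y ∈ rs} = J ⊓ K →
        Ideal.span {y | y ∈ rs} = J ∨ Ideal.span {y | y ∈ rs} = K

/-- A Noetherian ring is Gorenstein if all its localizations at primes are Gorenstein
local rings. -/
def IsGorensteinRing (S : Type*) [CommRing S] : Prop :=
  IsNoetherianRing S ∧
    ∀ (P : Ideal S) [P.IsPrime], IsGorensteinLocalRing (Localization.AtPrime P)


open Polynomial in
theorem Polynomial.exists_isWeaklyRegular_ofList_eq {R : Type*} [CommRing R] [IsDomain R]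
    [IsPrincipalIdealRing R] (p : Ideal R[X]) [hp : p.IsPrime] :
    ∃ rs : List R[X], RingTheory.Sequence.IsWeaklyRegular R[X] rs ∧ Ideal.ofList rs = p := by
  by_cases h0 : p = ⊥
  · exact ⟨[], by simp, by simp [h0]⟩
  by_cases hc : p.comap C = ⊥
  · obtain ⟨f, hfp, hf⟩ := hp.exists_mem_prime_of_ne_bot h0
    refine ⟨[f], ?_, ?_⟩
    · rw [RingTheory.Sequence.isWeaklyRegular_singleton_iff]
      exact fun a b hab ↦ mul_left_cancel₀ hf.ne_zero (by simpa using hab)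
    · rw [Ideal.ofList_singleton]
      by_contra hne
      have hlt : Ideal.span {f} < p :=
        lt_of_le_of_ne (by simpa [Ideal.span_le] using hfp) hne
      have : (Ideal.span {f}).IsPrime := (Ideal.span_singleton_prime hf.ne_zero).2 hf
      have h1 := Ideal.height_add_one_le_of_lt_of_isPrime hlt
      have h2 := Ideal.height_add_one_le_of_lt_of_isPrime
        (bot_lt_iff_ne_bot.2 (by simpa using hf.ne_zero) : ⊥ < Ideal.span {f})
      let K := FractionRing R
      let S := Submonoid.map (C : R →+* R[X]) (nonZeroDivisors R)
      let : Algebra R[X] K[X] := Polynomial.algebra R K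
      have : IsLocalization S K[X] := Polynomial.isLocalization _ _
      have hdisj : Disjoint (S : Set R[X]) (p : Set R[X]) := by
        rw [Set.disjoint_left]
        rintro _ ⟨r, hr, rfl⟩ hrp
        have : r ∈ p.comap C := hrp
        rw [hc] at this
        exact nonZeroDivisors.ne_zero hr this
      have : (p.map (algebraMap R[X] K[X])).IsPrime :=
        IsLocalization.isPrime_of_isPrime_disjoint S _ _ hp hdisj
      have h3 := IsLocalization.height_under S (p.map (algebraMap R[X] K[X]))
      rw [IsLocalization.under_map_of_isPrime_disjoint S _ hp hdisj] at h3
      have h4 : ((p.map (algebraMap R[X] K[X])).height : WithBot ℕ∞) ≤ 1 :=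
        (Ideal.height_le_ringKrullDim_of_ne_top Ideal.IsPrime.ne_top').trans
          (Ring.krullDimLE_iff.1 inferInstance)
      rw [← h3] at h4
      have h5 : p.height ≤ 1 := by exact_mod_cast h4
      have h6 : (2 : ℕ∞) ≤ 1 := by
        calc (2 : ℕ∞) = 0 + 1 + 1 := by norm_num
          _ ≤ (⊥ : Ideal R[X]).height + 1 + 1 := by gcongr; exact bot_le
          _ ≤ 1 := (add_le_add_left h2 1).trans (h1.trans h5)
      exact absurd h6 (by decide)
  · have hprime : (p.comap C).IsPrime := inferInstance
    have hmax : (p.comap C).IsMaximal := hprime.isMaximal hc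
    obtain ⟨π, hπ⟩ := IsPrincipalIdealRing.principal (p.comap C)
    have hπ : p.comap C = Ideal.span {π} := hπ
    have hπ0 : π ≠ 0 := by rintro rfl; exact hc (by simpa using hπ)
    have hmap : (p.comap C).map C = Ideal.span {(C π : R[X])} := by
      rw [hπ, Ideal.map_span, Set.image_singleton]
    have hreg : IsSMulRegular R[X] (C π : R[X]) := fun a b hab ↦
      mul_left_cancel₀ (C_ne_zero.2 hπ0) (by simpa using hab)
    by_cases heq : p = (p.comap C).map C
    · refine ⟨[C π], ?_, ?_⟩
      · rwa [RingTheory.Sequence.isWeaklyRegular_singleton_iff]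
      · rw [Ideal.ofList_singleton, ← hmap, ← heq]
    · obtain ⟨y, hy, hpy⟩ := Polynomial.exists_monic_span_sup_map_eq R p hmax heq
      refine ⟨[C π, y], ?_, ?_⟩
      · rw [RingTheory.Sequence.isWeaklyRegular_cons_iff,
          RingTheory.Sequence.isWeaklyRegular_singleton_iff]
        refine ⟨hreg, ?_⟩
        have hPr : (Ideal.span {(C π : R[X])}).IsPrime := by
          rw [← hmap]; exact Ideal.isPrime_map_C_of_isPrime
        have hyn : y ∉ Ideal.span {(C π : R[X])} := by
          intro hmem
          rw [← hmap, Ideal.mem_map_C_iff] at hmem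
          have := hmem y.natDegree
          rw [hy.coeff_natDegree] at this
          exact hprime.ne_top ((Ideal.eq_top_iff_one _).2 this)
        rw [isSMulRegular_iff_right_eq_zero_of_smul]
        intro m
        obtain ⟨m, rfl⟩ := Submodule.Quotient.mk_surjective _ m
        rw [← Submodule.Quotient.mk_smul, Submodule.Quotient.mk_eq_zero,
          Submodule.Quotient.mk_eq_zero, ← Submodule.ideal_span_singleton_smul]
        simp only [smul_eq_mul, Ideal.mul_top]
        exact fun h ↦ (hPr.mem_or_mem h).resolve_left hyn
      · rw [Ideal.ofList_cons, Ideal.ofList_singleton, ← hmap]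
        exact hpy.symm

theorem RingEquiv.exists_isWeaklyRegular_ofList_eq {R S : Type*} [CommRing R] [CommRing S]
    (e : R ≃+* S) (p : Ideal S)
    (h : ∃ rs : List R, RingTheory.Sequence.IsWeaklyRegular R rs ∧ Ideal.ofList rs = p.comap e) :
    ∃ rs : List S, RingTheory.Sequence.IsWeaklyRegular S rs ∧ Ideal.ofList rs = p := by
  obtain ⟨rs, hrs, hp⟩ := h
  refine ⟨rs.map e, ?_, ?_⟩
  · refine (AddEquiv.isWeaklyRegular_congr (e := e.toAddEquiv) ?_).1 hrs
    exact List.forall₂_map_right_iff.mpr (List.forall₂_same.mpr fun r _ x ↦ by simp)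
  · have := Ideal.map_ofList (e : R →+* S) rs
    rw [hp] at this
    rw [← RingEquiv.coe_toRingHom, ← this]
    exact Ideal.map_comap_of_surjective _ e.surjective p

theorem MvPolynomial.exists_isWeaklyRegular_ofList_eq {k : Type*} [Field k]
    (p : Ideal (MvPolynomial (Fin 2) k)) [p.IsPrime] :
    ∃ rs : List (MvPolynomial (Fin 2) k),
      RingTheory.Sequence.IsWeaklyRegular (MvPolynomial (Fin 2) k) rs ∧ Ideal.ofList rs = p := by
  have : IsPrincipalIdealRing (MvPolynomial (Fin 1) k) :=
    IsPrincipalIdealRing.of_surjective (MvPolynomial.uniqueAlgEquiv k (Fin 1)).symm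
      (MvPolynomial.uniqueAlgEquiv k (Fin 1)).symm.surjective
  refine RingEquiv.exists_isWeaklyRegular_ofList_eq (finSuccEquiv k 1).symm.toRingEquiv p ?_
  exact Polynomial.exists_isWeaklyRegular_ofList_eq _


theorem IsLocalRing.ringKrullDim_eq_length_of_isRegular {R : Type*} [CommRing R] [IsLocalRing R]
    [IsNoetherianRing R] {rs : List R} (hreg : RingTheory.Sequence.IsRegular R rs)
    (hmin : maximalIdeal R ∈ (Ideal.ofList rs).minimalPrimes) :
    ringKrullDim R = rs.length := by
  rw [← ringKrullDim_add_length_eq_ringKrullDim_of_isRegular rs hreg]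
  have hne : Ideal.ofList rs ≠ ⊤ := fun h ↦
    (maximalIdeal.isMaximal R).ne_top (top_le_iff.1 (h ▸ hmin.1.2))
  have : Nontrivial (R ⧸ Ideal.ofList rs) := Ideal.Quotient.nontrivial_iff.2 hne
  have : Ring.KrullDimLE 0 (R ⧸ Ideal.ofList rs) := by
    rw [Ideal.krullDimLE_zero_quotient_iff_forall_minimalPrimes_isMaximal]
    intro J hJ
    have hle : J ≤ maximalIdeal R := le_maximalIdeal hJ.1.1.ne_top
    rw [le_antisymm hle (hmin.2 hJ.1 hle)]
    exact maximalIdeal.isMaximal R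
  rw [ringKrullDimZero_iff_ringKrullDim_eq_zero.1 this, zero_add]

theorem ringDepth_maximalIdeal_eq_length {R : Type*} [CommRing R] [IsLocalRing R]
    [IsNoetherianRing R] {rs : List R} (hreg : RingTheory.Sequence.IsRegular R rs)
    (hmem : ∀ y ∈ rs, y ∈ maximalIdeal R) (hdim : ringKrullDim R = rs.length) :
    ringDepth (maximalIdeal R) = rs.length := by
  refine IsGreatest.csSup_eq ⟨⟨rs, rfl, hmem, hreg⟩, ?_⟩
  rintro _ ⟨ss, rfl, -, hss⟩
  have h := ringKrullDim_add_length_eq_ringKrullDim_of_isRegular ss hss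
  have hne : Ideal.ofList ss ≠ ⊤ := fun h ↦ hss.2 (by simp [h])
  have : Nontrivial (R ⧸ Ideal.ofList ss) := Ideal.Quotient.nontrivial_iff.2 hne
  have h0 : (0 : WithBot ℕ∞) ≤ ringKrullDim (R ⧸ Ideal.ofList ss) :=
    ringKrullDim_nonneg_of_nontrivial
  rw [hdim] at h
  have : (ss.length : WithBot ℕ∞) ≤ rs.length := by
    rw [← h]; exact le_add_of_nonneg_left h0
  exact_mod_cast this

section FlatExtension

variable {B A : Type*} [CommRing B] [CommRing A] [Algebra B A] [Module.Finite B A]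
  [Module.Flat B A] [IsNoetherianRing B]

/-- A regular sequence generating the contraction of a prime `P` along a finite flat extension
extends to a regular system of parameters of the localization at `P`. -/
theorem exists_isRegular_localization_atPrime (P : Ideal A) [P.IsPrime]
    (hP : ∃ rs : List B, RingTheory.Sequence.IsWeaklyRegular B rs ∧
      Ideal.ofList rs = P.under B) :
    ∃ rs : List (Localization.AtPrime P),
      (∀ y ∈ rs, y ∈ maximalIdeal (Localization.AtPrime P)) ∧
      RingTheory.Sequence.IsRegular (Localization.AtPrime P) rs ∧
      ringKrullDim (Localization.AtPrime P) = rs.length ∧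
      Ideal.ofList rs = ((P.under B).map (algebraMap B A)).map
        (algebraMap A (Localization.AtPrime P)) := by
  obtain ⟨rs, hrs, hp⟩ := hP
  have : IsNoetherianRing A := IsNoetherianRing.of_finite B A
  have hmemP : ∀ r ∈ rs.map (algebraMap B A), r ∈ P := by
    intro r hr
    obtain ⟨b, hb, rfl⟩ := List.mem_map.1 hr
    have : b ∈ P.under B := hp ▸ Ideal.subset_span hb
    exact this
  have hreg := (hrs.of_flat (S := A)).isRegular_of_isLocalization_of_mem
    (Localization.AtPrime P) P hmemP
  have hI : Ideal.ofList ((rs.map (algebraMap B A)).map (algebraMap A (Localization.AtPrime P)))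
      = ((P.under B).map (algebraMap B A)).map (algebraMap A (Localization.AtPrime P)) := by
    rw [← hp, Ideal.map_ofList, Ideal.map_ofList]
  have hmem : ∀ y ∈ (rs.map (algebraMap B A)).map (algebraMap A (Localization.AtPrime P)),
      y ∈ maximalIdeal (Localization.AtPrime P) := by
    intro y hy
    obtain ⟨a, ha, rfl⟩ := List.mem_map.1 hy
    exact (IsLocalization.AtPrime.to_map_mem_maximal_iff _ P a).2 (hmemP a ha)
  refine ⟨_, hmem, hreg, IsLocalRing.ringKrullDim_eq_length_of_isRegular hreg ?_, hI⟩
  rw [hI]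
  refine ⟨⟨inferInstance, ?_⟩, ?_⟩
  · rw [← hI]
    exact Ideal.span_le.2 hmem
  · rintro Q ⟨hQ, hIQ⟩ -
    have hQP : Q.under A ≤ P := by
      exact (Ideal.comap_mono (le_maximalIdeal hQ.ne_top)).trans_eq
        (IsLocalization.AtPrime.under_maximalIdeal (Localization.AtPrime P) P)
    have hPQ : P ≤ Q.under A :=
      (Ideal.IsIntegral.mem_minimalPrimes_map_under (R := B) P).2
        ⟨inferInstance, Ideal.map_le_iff_le_comap.1 hIQ⟩ hQP
    rw [← Localization.AtPrime.map_eq_maximalIdeal]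
    exact Ideal.map_le_iff_le_comap.2 hPQ

theorem IsCohenMacaulayRing.of_finite_flat
    (hB : ∀ (p : Ideal B) [p.IsPrime], ∃ rs : List B,
      RingTheory.Sequence.IsWeaklyRegular B rs ∧ Ideal.ofList rs = p) :
    IsCohenMacaulayRing A := by
  have : IsNoetherianRing A := IsNoetherianRing.of_finite B A
  refine ⟨this, fun P _ ↦ ?_⟩
  obtain ⟨rs, hmem, hreg, hdim, -⟩ := exists_isRegular_localization_atPrime P (hB (P.under B))
  rw [IsCohenMacaulayLocalRing, ringDepth_maximalIdeal_eq_length hreg hmem hdim, hdim]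

end FlatExtension

theorem Ideal.exists_notMem_forall_mul_mem {A : Type*} [CommRing A] {P : Ideal A} [P.IsPrime]
    {I L : Ideal A} (hI : I.FG) (h : ∀ x ∈ I, ∃ s ∉ P, s * x ∈ L) :
    ∃ s ∉ P, ∀ x ∈ I, s * x ∈ L := by
  classical
  obtain ⟨S, rfl⟩ := hI
  have h' : ∀ x : S, ∃ s ∉ P, s * x.1 ∈ L := fun x ↦ h x (Ideal.subset_span x.2)
  choose s hs hsL using h'
  refine ⟨∏ x, s x, fun hmem ↦ ?_, fun x hx ↦ ?_⟩
  · obtain ⟨x, -, hx⟩ := (Ideal.IsPrime.prod_mem_iff).1 hmem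
    exact hs x hx
  · induction hx using Submodule.span_induction with
    | mem x hx =>
      rw [← Finset.prod_erase_mul _ _ (Finset.mem_univ (⟨x, hx⟩ : S)), mul_assoc]
      exact L.mul_mem_left _ (hsL ⟨x, hx⟩)
    | zero => simp
    | add x y _ _ hx hy => rw [mul_add]; exact L.add_mem hx hy
    | smul a x _ hx =>
      rw [smul_eq_mul, mul_left_comm]; exact L.mul_mem_left _ hx

/-- Clearing denominators in the span over a residue field. -/
theorem Ideal.ResidueField.exists_smul_eq_of_mem_span {B M V : Type*} [CommRing B]
    (p : Ideal B) [p.IsPrime] [AddCommGroup M] [Module B M] [AddCommGroup V]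
    [Module p.ResidueField V] [Module B V] [IsScalarTower B p.ResidueField V]
    (f : M →ₗ[B] V) (N : Submodule B M) {v : V}
    (hv : v ∈ Submodule.span p.ResidueField (f '' N)) :
    ∃ d ∉ p, ∃ x ∈ N, d • v = f x := by
  induction hv using Submodule.span_induction with
  | mem v hv =>
    obtain ⟨x, hx, rfl⟩ := hv
    exact ⟨1, fun h ↦ Ideal.IsPrime.one_notMem ‹_› h, x, hx, one_smul _ _⟩
  | zero => exact ⟨1, fun h ↦ Ideal.IsPrime.one_notMem ‹_› h, 0, N.zero_mem, by simp⟩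
  | add v w _ _ hv hw =>
    obtain ⟨d, hd, x, hx, hdx⟩ := hv
    obtain ⟨c, hc, y, hy, hcy⟩ := hw
    refine ⟨c * d, fun h ↦ (Ideal.IsPrime.mem_or_mem ‹_› h).elim hc hd, c • x + d • y,
      N.add_mem (N.smul_mem _ hx) (N.smul_mem _ hy), ?_⟩
    rw [map_add, map_smul, map_smul, ← hdx, ← hcy, smul_add, mul_smul, mul_smul,
      smul_comm c d w]
  | smul a v _ hv =>
    obtain ⟨d, hd, x, hx, hdx⟩ := hv
    obtain ⟨b, c, hc, rfl⟩ := IsFractionRing.div_surjective (A := B ⧸ p) a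
    obtain ⟨b, rfl⟩ := Ideal.Quotient.mk_surjective b
    obtain ⟨c, rfl⟩ := Ideal.Quotient.mk_surjective c
    have hcp : c ∉ p := fun h ↦
      nonZeroDivisors.ne_zero hc (Ideal.Quotient.eq_zero_iff_mem.2 h)
    refine ⟨c * d, fun h ↦ (Ideal.IsPrime.mem_or_mem ‹_› h).elim hcp hd, b • x,
      N.smul_mem _ hx, ?_⟩
    have hc0 : algebraMap B p.ResidueField c ≠ 0 := by
      simpa [Ideal.algebraMap_residueField_eq_zero] using hcp
    rw [map_smul, ← hdx]
    simp only [← algebraMap_smul p.ResidueField (_ : B) (_ : V), smul_smul,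
      Ideal.algebraMap_quotient_residueField_mk, map_mul]
    congr 1
    field_simp

section Frobenius

variable {B A : Type*} [CommRing B] [CommRing A] [Algebra B A]

theorem Ideal.apply_mem_of_mem_map_algebraMap (l : A →ₗ[B] B) (p : Ideal B) {x : A}
    (hx : x ∈ p.map (algebraMap B A)) : l x ∈ p := by
  suffices h : ∀ y, l (y * x) ∈ p by simpa using h 1
  induction hx using Submodule.span_induction with
  | mem x hx =>
    obtain ⟨b, hb, rfl⟩ := hx
    intro y
    rw [mul_comm, ← Algebra.smul_def, map_smul]
    exact p.mul_mem_right _ hb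
  | zero => simp
  | add x z _ _ hx hz => intro y; rw [mul_add, map_add]; exact p.add_mem (hx y) (hz y)
  | smul a x _ hx => intro y; rw [smul_eq_mul, ← mul_assoc]; exact hx _

variable {ι : Type*} [Fintype ι] [IsNoetherianRing A]

/-- For a Frobenius extension `A` of `B`, with Frobenius form `l` and dual generating
families `e`, `e'`, the extension of `P ∩ B` is an irreducible ideal at `P`. -/
theorem forall_exists_mul_mem_or_of_frobenius (l : A →ₗ[B] B) (e e' : ι → A) (i₀ : ι)
    (he : e i₀ = 1) (hdual : ∀ x, x = ∑ i, l (e i * x) • e' i)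
    (P : Ideal A) [P.IsPrime] (J K : Ideal A)
    (hK : (P.under B).map (algebraMap B A) ≤ K) (hKs : ∀ s ∉ P, ∀ x, s * x ∈ K → x ∈ K)
    (hJK : ∀ x ∈ J, x ∈ K → ∃ s ∉ P, s * x ∈ (P.under B).map (algebraMap B A)) :
    (∀ x ∈ J, ∃ s ∉ P, s * x ∈ (P.under B).map (algebraMap B A)) ∨
      ∀ x ∈ K, ∃ s ∉ P, s * x ∈ (P.under B).map (algebraMap B A) := by
  classical
  set p := P.under B
  set L := p.map (algebraMap B A)
  obtain ⟨s, hs, hsL⟩ := Ideal.exists_notMem_forall_mul_mem (IsNoetherian.noetherian (J ⊓ K))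
    (fun x hx ↦ hJK x hx.1 hx.2)
  let F := p.ResidueField
  let Ψ : A →ₗ[B] (ι → F) := LinearMap.pi fun i ↦
    Algebra.linearMap B F ∘ₗ l ∘ₗ LinearMap.mulLeft B (e i)
  have hΨ (x : A) (i : ι) : Ψ x i = algebraMap B F (l (e i * x)) := rfl
  have hΨ0 (x : A) (hx : x ∈ L) : Ψ x = 0 := by
    ext i
    rw [hΨ, Pi.zero_apply, Ideal.algebraMap_residueField_eq_zero]
    exact Ideal.apply_mem_of_mem_map_algebraMap l p (L.mul_mem_left _ hx)
  have hL (x : A) (hx : ∀ y, l (y * x) ∈ p) : x ∈ L := by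
    rw [hdual x]
    refine L.sum_mem fun i _ ↦ ?_
    rw [Algebra.smul_def]
    exact L.mul_mem_right _ (Ideal.mem_map_of_mem _ (hx _))
  let scaled (I : Ideal A) : Submodule B A :=
    (I.restrictScalars B).map (LinearMap.mulLeft B s)
  let U := Submodule.span F (Ψ '' scaled J)
  let W := Submodule.span F (Ψ '' scaled K)
  have hdisj : Disjoint U W := by
    rw [Submodule.disjoint_def]
    intro v hvU hvW
    obtain ⟨c, hc, _, ⟨x, hx, rfl⟩, hcx⟩ :=
      Ideal.ResidueField.exists_smul_eq_of_mem_span p Ψ _ hvU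
    obtain ⟨d, hd, _, ⟨y, hy, rfl⟩, hdy⟩ :=
      Ideal.ResidueField.exists_smul_eq_of_mem_span p Ψ _ hvW
    simp only [LinearMap.mulLeft_apply] at hcx hdy
    have hx' : d • x ∈ J := by rw [Algebra.smul_def]; exact J.mul_mem_left _ hx
    have hy' : c • y ∈ K := by rw [Algebra.smul_def]; exact K.mul_mem_left _ hy
    have hsub : s * (d • x) - s * (c • y) ∈ L := by
      have h0 : Ψ (s * (d • x) - s * (c • y)) = 0 := by
        rw [map_sub, mul_smul_comm, mul_smul_comm, map_smul, map_smul, ← hcx, ← hdy,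
          smul_comm d c v, sub_self]
      rw [hdual (s * (d • x) - s * (c • y))]
      refine L.sum_mem fun i _ ↦ ?_
      rw [Algebra.smul_def]
      refine L.mul_mem_right _ (Ideal.mem_map_of_mem _ ?_)
      rw [← Ideal.algebraMap_residueField_eq_zero, ← hΨ, h0, Pi.zero_apply]
    have hxK : d • x ∈ K := by
      refine hKs s hs _ ?_
      have := K.add_mem (hK hsub) (K.mul_mem_left s hy')
      rwa [sub_add_cancel] at this
    have hz : Ψ (s * (d • x)) = 0 := hΨ0 _ (hsL _ ⟨hx', hxK⟩)
    rw [mul_smul_comm, map_smul, ← hcx, smul_smul, ← algebraMap_smul F] at hz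
    refine (smul_eq_zero.1 hz).resolve_left ?_
    rw [Ideal.algebraMap_residueField_eq_zero]
    exact fun h ↦ (Ideal.IsPrime.mem_or_mem inferInstance h).elim hd hc
  obtain ⟨U', hUU', hcompl⟩ := hdisj.exists_isCompl
  let φ : (ι → F) →ₗ[F] F :=
    LinearMap.proj i₀ ∘ₗ U'.subtype ∘ₗ Submodule.projectionOnto U' W hcompl
  have hφJ (x : A) (hx : x ∈ J) : φ (Ψ (s * x)) = algebraMap B F (l (s * x)) := by
    have hmem : Ψ (s * x) ∈ U' :=
      hUU' (Submodule.subset_span ⟨_, ⟨x, hx, rfl⟩, rfl⟩)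
    have := Submodule.projectionOnto_apply_left hcompl ⟨_, hmem⟩
    simp only [φ, LinearMap.comp_apply, this]
    simp [hΨ, he]
  have hφK (x : A) (hx : x ∈ K) : φ (Ψ (s * x)) = 0 := by
    have hmem : Ψ (s * x) ∈ W := Submodule.subset_span ⟨_, ⟨x, hx, rfl⟩, rfl⟩
    have := (Submodule.projectionOnto_apply_eq_zero_iff hcompl).2 hmem
    simp only [φ, LinearMap.comp_apply, this]
    simp
  obtain ⟨d, hd⟩ := IsLocalization.exist_integer_multiples_of_finite
    (nonZeroDivisors (B ⧸ p)) (fun i ↦ φ (Pi.single i 1))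
  obtain ⟨d, hdn⟩ := d
  obtain ⟨d, rfl⟩ := Ideal.Quotient.mk_surjective d
  have hdp : d ∉ p := fun h ↦
    nonZeroDivisors.ne_zero hdn (Ideal.Quotient.eq_zero_iff_mem.2 h)
  have hb : ∀ i, ∃ b : B, algebraMap B F b = algebraMap B F d * φ (Pi.single i 1) := by
    intro i
    obtain ⟨b, hb⟩ := hd i
    obtain ⟨b, rfl⟩ := Ideal.Quotient.mk_surjective b
    refine ⟨b, ?_⟩
    rw [Algebra.smul_def] at hb
    exact hb
  choose b hb using hb
  let z : A := ∑ i, b i • e i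
  have hz (x : A) : algebraMap B F (l (z * x)) = algebraMap B F d * φ (Ψ x) := by
    have h1 : φ (Ψ x) = ∑ i, Ψ x i * φ (Pi.single i 1) := by
      conv_lhs => rw [← Finset.univ_sum_single (Ψ x), map_sum]
      refine Finset.sum_congr rfl fun i _ ↦ ?_
      rw [← smul_eq_mul, ← map_smul, ← Pi.single_smul', smul_eq_mul, mul_one]
    rw [h1, Finset.mul_sum]
    simp only [z, Finset.sum_mul, map_sum, smul_mul_assoc, map_smul, smul_eq_mul, map_mul, hb, hΨ]
    exact Finset.sum_congr rfl fun i _ ↦ by ring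
  have hor : z ∉ P ∨ z - algebraMap B A d ∉ P := by
    by_contra! h
    have := P.sub_mem h.1 h.2
    rw [sub_sub_cancel] at this
    exact hdp this
  rcases hor with h | h
  · right
    intro x hx
    refine ⟨z * s, fun hmem ↦ (Ideal.IsPrime.mem_or_mem ‹_› hmem).elim h hs, hL _ fun y ↦ ?_⟩
    rw [← Ideal.algebraMap_residueField_eq_zero,
      show y * (z * s * x) = z * (s * (y * x)) by ring, hz, hφK _ (K.mul_mem_left _ hx), mul_zero]
  · left
    intro x hx
    refine ⟨(z - algebraMap B A d) * s,
      fun hmem ↦ (Ideal.IsPrime.mem_or_mem ‹_› hmem).elim h hs, hL _ fun y ↦ ?_⟩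
    have hd' : algebraMap B A d * (s * (y * x)) = d • (s * (y * x)) := (Algebra.smul_def _ _).symm
    rw [← Ideal.algebraMap_residueField_eq_zero,
      show y * ((z - algebraMap B A d) * s * x) =
        z * (s * (y * x)) - algebraMap B A d * (s * (y * x)) by ring,
      hd', map_sub, map_sub, hz, hφJ _ (J.mul_mem_left _ hx), map_smul, smul_eq_mul,
      map_mul (algebraMap B F) d, sub_self]

theorem IsGorensteinRing.of_frobenius [Module.Finite B A] [Module.Flat B A] [IsNoetherianRing B]
    (hB : ∀ (p : Ideal B) [p.IsPrime], ∃ rs : List B,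
      RingTheory.Sequence.IsWeaklyRegular B rs ∧ Ideal.ofList rs = p)
    (l : A →ₗ[B] B) (e e' : ι → A) (i₀ : ι)
    (he : e i₀ = 1) (hdual : ∀ x, x = ∑ i, l (e i * x) • e' i) :
    IsGorensteinRing A := by
  refine ⟨inferInstance, fun P _ ↦ ⟨(IsCohenMacaulayRing.of_finite_flat hB).2 P, ?_⟩⟩
  obtain ⟨rs, hmem, hreg, hdim, hI⟩ := exists_isRegular_localization_atPrime P (hB (P.under B))
  refine ⟨rs, hmem, hreg, hdim.symm, fun J K hJK ↦ ?_⟩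
  change Ideal.ofList rs = _ at hJK
  change Ideal.ofList rs = _ ∨ Ideal.ofList rs = _
  have hle (M : Ideal (Localization.AtPrime P)) (hM : ∀ x ∈ M.under A, ∃ s ∉ P,
      s * x ∈ (P.under B).map (algebraMap B A)) : M ≤ Ideal.ofList rs := by
    rw [← IsLocalization.map_under P.primeCompl _ M, Ideal.map_le_iff_le_comap, hI]
    intro x hx
    exact (IsLocalization.algebraMap_mem_map_algebraMap_iff P.primeCompl _ _ _).2 (hM x hx)
  have hJI : Ideal.ofList rs ≤ J := hJK ▸ inf_le_left
  have hKI : Ideal.ofList rs ≤ K := hJK ▸ inf_le_right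
  refine (forall_exists_mul_mem_or_of_frobenius l e e' i₀ he hdual P (J.under A) (K.under A)
    ?_ ?_ ?_).imp (fun h ↦ le_antisymm hJI (hle J h)) (fun h ↦ le_antisymm hKI (hle K h))
  · rw [hI] at hKI
    exact Ideal.map_le_iff_le_comap.1 hKI
  · intro s hs x hx
    have : algebraMap A (Localization.AtPrime P) (s * x) ∈ K := hx
    rw [map_mul] at this
    exact (Ideal.unit_mul_mem_iff_mem K
      (IsLocalization.map_units (M := P.primeCompl) _ ⟨s, hs⟩)).1 this
  · intro x hxJ hxK
    have : algebraMap A (Localization.AtPrime P) x ∈ Ideal.ofList rs := hJK ▸ ⟨hxJ, hxK⟩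
    rw [hI] at this
    exact (IsLocalization.algebraMap_mem_map_algebraMap_iff P.primeCompl _ _ _).1 this

end Frobenius

section FiberCone

open MvPolynomial

variable (k : Type*) [Field k] (n : ℕ)

/-- The algebra `k[Xⁿ, X²Yⁿ⁻², XYⁿ⁻¹, Yⁿ]`. -/
noncomputable abbrev fiberConeAlgebra : Subalgebra k (MvPolynomial (Fin 2) k) :=
  Algebra.adjoin k {X 0 ^ n, X 0 ^ 2 * X 1 ^ (n - 2), X 0 * X 1 ^ (n - 1), X 1 ^ n}

namespace fiberConeAlgebra

/-- The parameter algebra `k[Xⁿ, Yⁿ] → k[Xⁿ, X²Yⁿ⁻², XYⁿ⁻¹, Yⁿ]`. -/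
noncomputable def ofParameters : MvPolynomial (Fin 2) k →ₐ[k] fiberConeAlgebra k n :=
  aeval ![⟨X 0 ^ n, Algebra.subset_adjoin (by simp)⟩, ⟨X 1 ^ n, Algebra.subset_adjoin (by simp)⟩]

theorem coe_ofParameters (p : MvPolynomial (Fin 2) k) :
    (ofParameters k n p : MvPolynomial (Fin 2) k) = expand n p := by
  suffices h : (fiberConeAlgebra k n).val.comp (ofParameters k n) = expand n from
    DFunLike.congr_fun h p
  refine MvPolynomial.algHom_ext fun i ↦ ?_
  fin_cases i <;> simp [ofParameters]

noncomputable instance : Algebra (MvPolynomial (Fin 2) k) (fiberConeAlgebra k n) :=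
  (ofParameters k n).toRingHom.toAlgebra

variable {k n}

theorem coe_smul (p : MvPolynomial (Fin 2) k) (x : fiberConeAlgebra k n) :
    ((p • x : fiberConeAlgebra k n) : MvPolynomial (Fin 2) k) = expand n p * x := by
  rw [← coe_ofParameters]; rfl

variable (n) in
/-- The exponent of `Y` in the basis monomial whose exponent of `X` is `r`. -/
def yExponent (r : ℕ) : ℕ := n * ((r + 1) / 2) - r

theorem yExponent_add (hn : 2 ≤ n) (r : ℕ) : yExponent n r + r = n * ((r + 1) / 2) := by
  have : 2 * ((r + 1) / 2) ≤ n * ((r + 1) / 2) := Nat.mul_le_mul_right _ hn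
  unfold yExponent
  omega

variable (k) in
theorem monomial_mem (hn : 2 ≤ n) (r : ℕ) :
    (X 0 ^ r * X 1 ^ yExponent n r : MvPolynomial (Fin 2) k) ∈ fiberConeAlgebra k n := by
  have h : (X 0 ^ r * X 1 ^ yExponent n r : MvPolynomial (Fin 2) k) =
      (X 0 ^ 2 * X 1 ^ (n - 2)) ^ (r / 2) * (X 0 * X 1 ^ (n - 1)) ^ (r % 2) := by
    have h1 : r = 2 * (r / 2) + r % 2 := by omega
    have h2 : yExponent n r = (n - 2) * (r / 2) + (n - 1) * (r % 2) := by
      have := yExponent_add hn r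
      obtain ⟨m, rfl⟩ := Nat.exists_eq_add_of_le' hn
      obtain ⟨q, rfl | rfl⟩ := Nat.even_or_odd' r
      · rw [show (2 * q + 1) / 2 = q by omega] at this
        rw [show 2 * q / 2 = q by omega, show 2 * q % 2 = 0 by omega, Nat.add_sub_cancel]
        linarith
      · rw [show (2 * q + 1 + 1) / 2 = q + 1 by omega] at this
        rw [show (2 * q + 1) / 2 = q by omega, show (2 * q + 1) % 2 = 1 by omega,
          Nat.add_sub_cancel, show m + 2 - 1 = m + 1 by omega]
        linarith
    rw [h2]
    conv_lhs => enter [1]; rw [h1]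
    ring
  rw [h]
  exact mul_mem (pow_mem (Algebra.subset_adjoin (by simp)) _)
    (pow_mem (Algebra.subset_adjoin (by simp)) _)

variable (k) in
/-- The monomial in `fiberConeAlgebra k n` with `X`-exponent `r` of smallest degree. -/
noncomputable def basisMonomial (hn : 2 ≤ n) (r : ℕ) : fiberConeAlgebra k n :=
  ⟨X 0 ^ r * X 1 ^ yExponent n r, monomial_mem k hn r⟩

theorem basisMonomial_mul (hn : 2 ≤ n) (r s : ℕ) :
    basisMonomial k hn r * basisMonomial k hn s =
      (X 1 ^ ((r + 1) / 2 + (s + 1) / 2 - (r + s + 1) / 2) : MvPolynomial (Fin 2) k) •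
        basisMonomial k hn (r + s) := by
  have h : yExponent n r + yExponent n s =
      n * ((r + 1) / 2 + (s + 1) / 2 - (r + s + 1) / 2) + yExponent n (r + s) := by
    have hr := yExponent_add hn r
    have hs := yExponent_add hn s
    have hrs := yExponent_add hn (r + s)
    have : n * ((r + 1) / 2) + n * ((s + 1) / 2) =
        n * ((r + 1) / 2 + (s + 1) / 2 - (r + s + 1) / 2) + n * ((r + s + 1) / 2) := by
      rw [← mul_add, ← mul_add]
      congr 1
      omega
    omega
  apply Subtype.ext
  rw [coe_smul]
  simp only [basisMonomial, MulMemClass.mk_mul_mk, map_pow, expand_X]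
  rw [mul_mul_mul_comm, ← pow_add, ← pow_add, h]
  ring

theorem basisMonomial_add_self (hn : 2 ≤ n) (r : ℕ) :
    basisMonomial k hn (r + n) =
      (X 0 * X 1 ^ ((r + n + 1) / 2 - (r + 1) / 2 - 1) : MvPolynomial (Fin 2) k) •
        basisMonomial k hn r := by
  have h : yExponent n (r + n) =
      n * ((r + n + 1) / 2 - (r + 1) / 2 - 1) + yExponent n r := by
    have hr := yExponent_add hn r
    have hrn := yExponent_add hn (r + n)
    have : n * ((r + n + 1) / 2) =
        n * ((r + n + 1) / 2 - (r + 1) / 2 - 1) + n * ((r + 1) / 2) + n := by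
      rw [← mul_add, ← mul_add_one]
      congr 1
      omega
    omega
  apply Subtype.ext
  rw [coe_smul]
  simp only [basisMonomial, map_mul, map_pow, expand_X]
  rw [h]
  ring

theorem basisMonomial_zero (hn : 2 ≤ n) : basisMonomial k hn 0 = 1 := by
  apply Subtype.ext
  simp [basisMonomial, yExponent]

theorem linearIndependent_basisMonomial (hn : 2 ≤ n) :
    LinearIndependent (MvPolynomial (Fin 2) k) fun r : Fin n ↦ basisMonomial k hn r := by
  rw [Fintype.linearIndependent_iff]
  intro g hg j
  let m (r : ℕ) : Fin 2 →₀ ℕ := Finsupp.single 0 r + Finsupp.single 1 (yExponent n r)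
  have hm (r : ℕ) : (basisMonomial k hn r : MvPolynomial (Fin 2) k) = monomial (m r) 1 := by
    simp [basisMonomial, m, X_pow_eq_monomial, monomial_mul]
  ext u
  have h := congrArg (fun x : fiberConeAlgebra k n ↦ coeff (n • u + m j) x.1) hg
  simp only [AddSubmonoidClass.coe_finsetSum, coe_smul, hm, coeff_sum, ZeroMemClass.coe_zero,
    coeff_zero] at h
  rw [Finset.sum_eq_single_of_mem j (Finset.mem_univ j), coeff_mul_monomial, mul_one,
    coeff_expand_smul n (by omega)] at h
  · simpa using h
  · intro i _ hij
    rw [coeff_mul_monomial']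
    split_ifs with hle
    · rw [mul_one]
      refine coeff_expand_of_not_dvd (i := 0) _ fun hdvd ↦ hij (Fin.ext ?_)
      have h0 := hle 0
      simp only [m, Finsupp.coe_add, Finsupp.coe_tsub, Finsupp.coe_smul, Pi.add_apply, Pi.sub_apply,
        Pi.smul_apply, Finsupp.single_eq_same, smul_eq_mul, Finsupp.single_apply, one_ne_zero,
        if_false, add_zero] at h0 hdvd
      have hmod := (Nat.modEq_iff_dvd' h0).2 hdvd
      rw [Nat.ModEq, Nat.mul_add_mod, Nat.mod_eq_of_lt i.2, Nat.mod_eq_of_lt j.2] at hmod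
      exact hmod
    · rfl

theorem span_basisMonomial (hn : 2 ≤ n) :
    Submodule.span (MvPolynomial (Fin 2) k) (Set.range fun r : Fin n ↦ basisMonomial k hn r) =
      ⊤ := by
  set N := Submodule.span (MvPolynomial (Fin 2) k)
    (Set.range fun r : Fin n ↦ basisMonomial k hn r)
  have hlt (r : ℕ) (hr : r < n) : basisMonomial k hn r ∈ N :=
    Submodule.subset_span ⟨⟨r, hr⟩, rfl⟩
  have hmem (r : ℕ) : basisMonomial k hn r ∈ N := by
    induction r using Nat.strong_induction_on with
    | _ r ih =>
      rcases lt_or_ge r n with h | h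
      · exact hlt r h
      · obtain ⟨r, rfl⟩ := Nat.exists_eq_add_of_le' h
        rw [basisMonomial_add_self]
        exact N.smul_mem _ (ih r (by omega))
  have hone : (1 : fiberConeAlgebra k n) ∈ N := basisMonomial_zero (k := k) hn ▸ hmem 0
  have hcongr {x y : fiberConeAlgebra k n} (hy : y ∈ N)
      (hxy : (x : MvPolynomial (Fin 2) k) = y) : x ∈ N := Subtype.ext hxy ▸ hy
  rw [Submodule.eq_top_iff']
  rintro ⟨x, hx⟩
  induction hx using Algebra.adjoin_induction with
  | mem x hx =>
    rcases hx with rfl | rfl | rfl | rfl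
    · refine hcongr (N.smul_mem (X 0) hone) ?_
      rw [coe_smul]
      simp
    · refine hcongr (hmem 2) ?_
      simp [basisMonomial, yExponent]
    · refine hcongr (hmem 1) ?_
      simp [basisMonomial, yExponent]
    · refine hcongr (N.smul_mem (X 1) hone) ?_
      rw [coe_smul]
      simp
  | algebraMap r =>
    refine hcongr (N.smul_mem (C r) hone) ?_
    rw [coe_smul]
    simp [algebraMap_eq]
  | add x y hx hy hx' hy' => exact N.add_mem hx' hy'
  | mul x y hx hy hx' hy' =>
    have h : (⟨x, hx⟩ * ⟨y, hy⟩ : fiberConeAlgebra k n) ∈ N * N := Submodule.mul_mem_mul hx' hy'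
    rw [Submodule.span_mul_span] at h
    refine Submodule.span_le.2 ?_ h
    rintro _ ⟨_, ⟨r, rfl⟩, _, ⟨s, rfl⟩, rfl⟩
    simp only [basisMonomial_mul]
    exact N.smul_mem _ (hmem _)

variable (k) in
/-- The monomial basis of `fiberConeAlgebra k n` over the parameter algebra `k[Xⁿ, Yⁿ]`. -/
noncomputable def basis (hn : 2 ≤ n) :
    Module.Basis (Fin n) (MvPolynomial (Fin 2) k) (fiberConeAlgebra k n) :=
  Module.Basis.mk (linearIndependent_basisMonomial hn) (span_basisMonomial hn).ge

theorem basis_apply (hn : 2 ≤ n) (r : Fin n) : basis k hn r = basisMonomial k hn r := by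
  simp [basis]

theorem isCohenMacaulayRing (hn : 2 ≤ n) : IsCohenMacaulayRing (fiberConeAlgebra k n) := by
  have := Module.Finite.of_basis (basis k hn)
  have := Module.Free.of_basis (basis k hn)
  exact IsCohenMacaulayRing.of_finite_flat (B := MvPolynomial (Fin 2) k)
    fun p _ ↦ MvPolynomial.exists_isWeaklyRegular_ofList_eq p

theorem coord_last_basis_mul (hn : 2 ≤ n) (heven : Even n) (r s : Fin n) :
    (basis k hn).coord ⟨n - 1, by omega⟩ (basis k hn r * basis k hn s) =
      if r = s.rev then 1 else 0 := by
  have hcoord (t : ℕ) (ht : t < n) : (basis k hn).coord ⟨n - 1, by omega⟩ (basisMonomial k hn t) =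
      if t = n - 1 then 1 else 0 := by
    rw [← basis_apply hn ⟨t, ht⟩, Module.Basis.coord_apply, Module.Basis.repr_self,
      Finsupp.single_apply]
    simp
  have hiff : r = s.rev ↔ r.1 + s.1 = n - 1 := by
    rw [Fin.ext_iff, Fin.val_rev]
    omega
  obtain ⟨m, rfl⟩ := heven
  rw [basis_apply, basis_apply, basisMonomial_mul, map_smul]
  rcases lt_or_ge (r.1 + s.1) (m + m) with h | h
  · rw [hcoord _ h]
    by_cases hrs : r.1 + s.1 = m + m - 1
    · rw [if_pos hrs, if_pos (hiff.2 hrs),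
        show (r.1 + 1) / 2 + (s.1 + 1) / 2 - (r.1 + s.1 + 1) / 2 = 0 by omega]
      simp
    · rw [if_neg hrs, if_neg (mt hiff.1 hrs), smul_zero]
  · obtain ⟨t, ht⟩ := Nat.exists_eq_add_of_le' h
    rw [ht, basisMonomial_add_self, map_smul, hcoord t (by omega), if_neg (by omega),
      if_neg (by omega), smul_zero, smul_zero]

theorem isGorensteinRing (hn : 2 ≤ n) (heven : Even n) :
    IsGorensteinRing (fiberConeAlgebra k n) := by
  have := Module.Finite.of_basis (basis k hn)
  have := Module.Free.of_basis (basis k hn)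
  have : IsNoetherianRing (fiberConeAlgebra k n) :=
    IsNoetherianRing.of_finite (MvPolynomial (Fin 2) k) _
  let l := (basis k hn).coord ⟨n - 1, by omega⟩
  have hdual : LinearMap.id = ∑ i, (l ∘ₗ LinearMap.mulLeft (MvPolynomial (Fin 2) k)
      (basis k hn i)).smulRight (basis k hn i.rev) := by
    refine (basis k hn).ext fun s ↦ ?_
    simp only [LinearMap.id_apply, LinearMap.sum_apply, LinearMap.smulRight_apply,
      LinearMap.comp_apply, LinearMap.mulLeft_apply, l, coord_last_basis_mul hn heven]
    simp
  refine IsGorensteinRing.of_frobenius (B := MvPolynomial (Fin 2) k)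
    (fun p _ ↦ MvPolynomial.exists_isWeaklyRegular_ofList_eq p) l (basis k hn)
    (fun i ↦ basis k hn i.rev) ⟨0, by omega⟩ ?_ fun x ↦ ?_
  · rw [basis_apply, basisMonomial_zero]
  · simpa using DFunLike.congr_fun hdual x

end fiberConeAlgebra

end FiberCone

/-- For a field `k` and `n ≥ 4`, the subalgebra
`A = k[Xⁿ, X²Y^{n-2}, XY^{n-1}, Yⁿ]` of `k[X,Y]` is Cohen–Macaulay, and if `n` is even
then `A` is Gorenstein. -/
theorem fiberConeAlgebra_CM_and_gorenstein_of_even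
    (k : Type*) [Field k] (n : ℕ) (hn : 4 ≤ n)
    (X Y : MvPolynomial (Fin 2) k)
    (hX : X = MvPolynomial.X 0) (hY : Y = MvPolynomial.X 1) :
    IsCohenMacaulayRing
      (Algebra.adjoin k
        ({X ^ n, X ^ 2 * Y ^ (n - 2), X * Y ^ (n - 1), Y ^ n} :
          Set (MvPolynomial (Fin 2) k))) ∧
      (Even n →
        IsGorensteinRing
          (Algebra.adjoin k
            ({X ^ n, X ^ 2 * Y ^ (n - 2), X * Y ^ (n - 1), Y ^ n} :
              Set (MvPolynomial (Fin 2) k)))) := by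
  subst hX hY
  exact ⟨fiberConeAlgebra.isCohenMacaulayRing (by omega),
    fun heven ↦ fiberConeAlgebra.isGorensteinRing (by omega) heven⟩
end
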